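/- Let K be a number field of degree at most 2 over ℚ. Then the only triples (x,y,z) ∈ K³ satisfying both y² = −(x² − 3)(x² + 1) and z² = −2(x³ − x² − x − 1) are the eight triples with x ∈ {1, −1}, y ∈ {2, −2}, and z ∈ {2, −2}. -/

import Mathlib

theorem exists_sq_of_coprime_mul_eq_prime_mul_sq_aux {ℓ S T m : ℤ} (hm : m ≠ 0)
    (hST : IsCoprime S (ℓ * T)) (h : S * T = m ^ 2) :
    ∃ u w : ℤ, m = u * w ∧ IsCoprime (ℓ * u) w ∧
      (S + ℓ * T) ^ 2 = (ℓ * u ^ 2 + w ^ 2) ^ 2 ∧ (S - ℓ * T) ^ 2 = (ℓ * u ^ 2 - w ^ 2) ^ 2 := by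
  have hco : IsCoprime S T := hST.of_mul_right_right
  obtain ⟨w, hw⟩ := Int.sq_of_isCoprime hco h
  obtain ⟨u, hu⟩ := Int.sq_of_isCoprime hco.symm (by rw [mul_comm, h])
  have hm2 : 0 < m ^ 2 := by positivity
  have key : ∃ w : ℤ, m = u * w ∧ (S = w ^ 2 ∧ T = u ^ 2 ∨ S = -w ^ 2 ∧ T = -u ^ 2) := by
    have hcases : S = w ^ 2 ∧ T = u ^ 2 ∨ S = -w ^ 2 ∧ T = -u ^ 2 := by
      rcases hw with hw | hw <;> rcases hu with hu | hu
      · exact Or.inl ⟨hw, hu⟩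
      · rw [hw, hu] at h
        nlinarith [mul_nonneg (sq_nonneg w) (sq_nonneg u)]
      · rw [hw, hu] at h
        nlinarith [mul_nonneg (sq_nonneg w) (sq_nonneg u)]
      · exact Or.inr ⟨hw, hu⟩
    have hsq : m ^ 2 = (u * w) ^ 2 := by
      rcases hcases with ⟨h1, h2⟩ | ⟨h1, h2⟩ <;> rw [← h, h1, h2] <;> ring
    rcases sq_eq_sq_iff_eq_or_eq_neg.mp hsq with h1 | h1
    · exact ⟨w, h1, hcases⟩
    · exact ⟨-w, by rw [h1]; ring, by simpa using hcases⟩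
  obtain ⟨w, hmw, hc⟩ := key
  refine ⟨u, w, hmw, ?_, ?_, ?_⟩
  · have h1 : IsCoprime (w ^ 2) (ℓ * u ^ 2) := by
      rcases hc with ⟨h1, h2⟩ | ⟨h1, h2⟩
      · rwa [h1, h2] at hST
      · rw [h1, h2, mul_neg] at hST
        exact (IsCoprime.neg_neg_iff _ _).mp hST
    have h2 : IsCoprime w (ℓ * u ^ 2) := (IsCoprime.pow_left_iff two_pos).mp h1
    exact (h2.of_isCoprime_of_dvd_right ⟨u, by ring⟩).symm
  · rcases hc with ⟨h1, h2⟩ | ⟨h1, h2⟩ <;> rw [h1, h2] <;> ring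
  · rcases hc with ⟨h1, h2⟩ | ⟨h1, h2⟩ <;> rw [h1, h2] <;> ring

/-- Parametrization of the factorizations of a prime times a square into coprime factors. -/
theorem exists_sq_of_coprime_mul_eq_prime_mul_sq {ℓ S T m : ℤ} (hℓ : Prime ℓ)
    (hm : m ≠ 0) (hST : IsCoprime S T) (h : S * T = ℓ * m ^ 2) :
    ∃ u w : ℤ, m = u * w ∧ IsCoprime (ℓ * u) w ∧
      (S + T) ^ 2 = (ℓ * u ^ 2 + w ^ 2) ^ 2 ∧ (S - T) ^ 2 = (ℓ * u ^ 2 - w ^ 2) ^ 2 := by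
  rcases hℓ.dvd_or_dvd (show ℓ ∣ S * T from ⟨_, h⟩) with ⟨S', rfl⟩ | ⟨T', rfl⟩
  · have h' : T * S' = m ^ 2 := mul_left_cancel₀ hℓ.ne_zero (by linear_combination h)
    obtain ⟨u, w, h1, h2, h3, h4⟩ :=
      exists_sq_of_coprime_mul_eq_prime_mul_sq_aux hm hST.symm h'
    exact ⟨u, w, h1, h2, by rw [← h3]; ring, by rw [← h4]; ring⟩
  · exact exists_sq_of_coprime_mul_eq_prime_mul_sq_aux hm hST
      (mul_left_cancel₀ hℓ.ne_zero (by linear_combination h))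

/-- Parametrization of the primitive solutions of `X² = Y² + 4ℓm²` with `X` odd. -/
theorem exists_param_sq_eq_sq_add {ℓ X Y m : ℤ} (hℓ : Prime ℓ) (hm : m ≠ 0)
    (hX : Odd X) (hco : IsCoprime X (ℓ * m)) (h : X ^ 2 = Y ^ 2 + 4 * ℓ * m ^ 2) :
    ∃ u w : ℤ, m = u * w ∧ IsCoprime (ℓ * u) w ∧
      X ^ 2 = (ℓ * u ^ 2 + w ^ 2) ^ 2 ∧ Y ^ 2 = (ℓ * u ^ 2 - w ^ 2) ^ 2 := by
  have hY : Odd Y := by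
    have : Odd (Y ^ 2) := by
      rw [show Y ^ 2 = X ^ 2 - 2 * (2 * ℓ * m ^ 2) by linear_combination -h]
      exact hX.pow.sub_even (even_two_mul _)
    exact (Int.odd_pow' two_ne_zero).mp this
  obtain ⟨S, hS⟩ : ∃ S, X + Y = 2 * S := (hX.add_odd hY).two_dvd
  obtain ⟨T, hT⟩ : ∃ T, X - Y = 2 * T := (hX.sub_odd hY).two_dvd
  have hXS : X = S + T := by linarith
  have hYS : Y = S - T := by linarith
  have hprod : S * T = ℓ * m ^ 2 := by
    rw [hXS, hYS] at h
    linarith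
  have h1 : IsCoprime (S + T) (S * T) := by
    rw [← hXS, hprod]
    have := IsCoprime.mul_right hco hco.of_mul_right_right
    exact this.of_isCoprime_of_dvd_right ⟨1, by ring⟩
  have h2 : IsCoprime S T := by
    have := h1.of_mul_right_left
    rw [isCoprime_comm] at this
    simpa using (IsCoprime.add_mul_left_right_iff (z := 1)).mp (by simpa [add_comm] using this)
  obtain ⟨u, w, h3, h4, h5, h6⟩ := exists_sq_of_coprime_mul_eq_prime_mul_sq hℓ hm h2 hprod
  exact ⟨u, w, h3, h4, by rw [hXS, h5], by rw [hYS, h6]⟩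

theorem isCoprime_sq_add_mul_sq {m n : ℤ} (k c : ℤ) (h : IsCoprime m n)
    (hc : IsCoprime c (k * m ^ 2 + n ^ 2)) :
    IsCoprime ((k + c) * m ^ 2 + n ^ 2) (k * m ^ 2 + n ^ 2) := by
  have h1 : IsCoprime (m ^ 2) (k * m ^ 2 + n ^ 2) := by
    rw [add_comm, mul_comm]
    exact (IsCoprime.add_mul_left_right_iff).mpr (h.pow)
  have h2 := (hc.mul_left h1)
  rw [show (k + c) * m ^ 2 + n ^ 2 = c * m ^ 2 + (k * m ^ 2 + n ^ 2) * 1 by ring]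
  exact IsCoprime.add_mul_left_left h2 1

theorem Int.exists_sq_and_sq_of_isCoprime {a b c : ℤ} (h : IsCoprime a b) (hc : c ≠ 0)
    (heq : a * b = c ^ 2) :
    (∃ s t : ℤ, a = s ^ 2 ∧ b = t ^ 2) ∨ (∃ s t : ℤ, a = -s ^ 2 ∧ b = -t ^ 2) := by
  obtain ⟨s, hs⟩ := Int.sq_of_isCoprime h heq
  obtain ⟨t, ht⟩ := Int.sq_of_isCoprime h.symm (by rw [mul_comm, heq])
  have hc2 : 0 < c ^ 2 := by positivity
  rcases hs with hs | hs <;> rcases ht with ht | ht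
  · exact Or.inl ⟨s, t, hs, ht⟩
  · rw [hs, ht] at heq
    nlinarith [mul_nonneg (sq_nonneg s) (sq_nonneg t)]
  · rw [hs, ht] at heq
    nlinarith [mul_nonneg (sq_nonneg s) (sq_nonneg t)]
  · exact Or.inr ⟨s, t, hs, ht⟩

theorem Int.isCoprime_three_of_not_dvd {a : ℤ} (h : ¬ (3 : ℤ) ∣ a) : IsCoprime 3 a :=
  (Int.prime_three.coprime_iff_not_dvd).mpr h

theorem Int.isCoprime_two_of_odd {a : ℤ} (h : Odd a) : IsCoprime 2 a := by
  obtain ⟨k, rfl⟩ := h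
  exact ⟨-k, 1, by ring⟩

theorem Int.sq_emod_eight_of_odd {a : ℤ} (h : Odd a) : a ^ 2 % 8 = 1 := by
  obtain ⟨k, rfl⟩ := h
  obtain ⟨j, hj⟩ := (Int.even_mul_succ_self k)
  have : (2 * k + 1) ^ 2 = 8 * j + 1 := by linear_combination 4 * hj
  omega

theorem Int.sq_emod_four_of_even {a : ℤ} (h : Even a) : a ^ 2 % 4 = 0 := by
  obtain ⟨k, rfl⟩ := h
  have : (k + k) ^ 2 = 4 * k ^ 2 := by ring
  omega

theorem Int.sq_emod_four_of_odd {a : ℤ} (h : Odd a) : a ^ 2 % 4 = 1 := by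
  have := Int.sq_emod_eight_of_odd h
  omega

/-- `p² + q²` and `p² - 3q²` are not both squares for coprime `p`, `q` with `q` even and nonzero. -/
theorem eq_zero_of_sq_add_sq_of_sq_sub_three_mul_sq (N : ℕ) : ∀ p q a b : ℤ, q.natAbs ≤ N →
    IsCoprime p q → Even q → p ^ 2 + q ^ 2 = b ^ 2 → p ^ 2 - 3 * q ^ 2 = a ^ 2 → q = 0 := by
  induction N with
  | zero => intro p q a b hN _ _ _ _; omega
  | succ N ih =>
    intro p q a b hN hco hq hb ha
    by_contra hq0
    have hp : Odd p := by
      rw [← Int.not_even_iff_odd]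
      intro hp
      exact Int.prime_two.not_isUnit (hco.isUnit_of_dvd' hp.two_dvd hq.two_dvd)
    have h3p : ¬ (3 : ℤ) ∣ p := by
      rintro ⟨k, rfl⟩
      have h3a : (3 : ℤ) ∣ a := Int.prime_three.dvd_of_dvd_pow (n := 2)
        ⟨3 * k ^ 2 - q ^ 2, by rw [← ha]; ring⟩
      obtain ⟨j, rfl⟩ := h3a
      have h3q : (3 : ℤ) ∣ q := Int.prime_three.dvd_of_dvd_pow (n := 2)
        ⟨k ^ 2 - j ^ 2, by linarith⟩
      exact Int.prime_three.not_isUnit (hco.isUnit_of_dvd' ⟨k, rfl⟩ h3q)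
    obtain ⟨k, hk⟩ := hq.two_dvd
    have hk0 : k ≠ 0 := by rintro rfl; exact hq0 (by simpa using hk)
    have hck : IsCoprime p (3 * k) :=
      (Int.isCoprime_three_of_not_dvd h3p).symm.mul_right
        (hco.of_isCoprime_of_dvd_right ⟨2, by rw [hk]; ring⟩)
    obtain ⟨m, n, hmn, hcmn, hpm, -⟩ := exists_param_sq_eq_sq_add (Y := a) Int.prime_three
      hk0 hp hck (by rw [← ha, hk]; ring)
    have hcm : IsCoprime m n := hcmn.of_mul_left_right
    have hodd : Odd (3 * m ^ 2 + n ^ 2) :=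
      (Int.odd_pow' two_ne_zero).mp (hpm ▸ hp.pow)
    have hodd' : Odd (1 * m ^ 2 + n ^ 2) := by
      rw [show 1 * m ^ 2 + n ^ 2 = 3 * m ^ 2 + n ^ 2 - 2 * m ^ 2 by ring]
      exact hodd.sub_even (even_two_mul _)
    have hc8 : IsCoprime (8 : ℤ) (1 * m ^ 2 + n ^ 2) :=
      (Int.isCoprime_two_of_odd hodd').pow_left (m := 3)
    have hcop := isCoprime_sq_add_mul_sq 1 8 hcm hc8
    have hb0 : b ≠ 0 := by
      rintro rfl
      have : 0 < q ^ 2 := by positivity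
      nlinarith [sq_nonneg p]
    have hm0 : m ≠ 0 := by rintro rfl; simp at hmn; exact hk0 hmn
    have hn0 : n ≠ 0 := by rintro rfl; simp at hmn; exact hk0 hmn
    have hm2 : 0 < m ^ 2 := by positivity
    obtain ⟨c, e, hc, he⟩ | ⟨c, e, hc, he⟩ := Int.exists_sq_and_sq_of_isCoprime hcop hb0
      (show _ = b ^ 2 by rw [← hb, hpm, hk, hmn]; ring)
    swap
    · nlinarith [sq_nonneg n, sq_nonneg c]
    have hcodd : Odd c := by
      refine (Int.odd_pow' two_ne_zero).mp (show Odd (c ^ 2) from ?_)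
      rw [← hc, show (1 + 8) * m ^ 2 + n ^ 2 = 3 * m ^ 2 + n ^ 2 + 2 * (3 * m ^ 2) by ring]
      exact hodd.add_even (even_two_mul _)
    have hccm : IsCoprime c (2 * m) := by
      refine IsCoprime.mul_right
        (Int.isCoprime_two_of_odd hcodd).symm ?_
      refine (IsCoprime.pow_left_iff (m := 2) two_pos).mp ?_
      rw [← hc, show (1 + 8) * m ^ 2 + n ^ 2 = n ^ 2 + m * (9 * m) by ring]
      exact IsCoprime.add_mul_left_left hcm.symm.pow_left _
    obtain ⟨u, w, huw, hcuw, -, heu⟩ := exists_param_sq_eq_sq_add (Y := e) Int.prime_two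
      hm0 hcodd hccm (by rw [← hc, ← he]; ring)
    have hu0 : u ≠ 0 := by rintro rfl; simp at huw; exact hm0 huw
    have hw0 : w ≠ 0 := by rintro rfl; simp at huw; exact hm0 huw
    have hwodd : Odd w := by
      rw [← Int.not_even_iff_odd]
      intro hw
      exact Int.prime_two.not_isUnit (hcuw.isUnit_of_dvd' ⟨u, rfl⟩ hw.two_dvd)
    have hn2 : (-4 * u ^ 2 + w ^ 2) * (-1 * u ^ 2 + w ^ 2) = n ^ 2 := by
      rw [show n ^ 2 = e ^ 2 - m ^ 2 by rw [← he]; ring, heu, huw]; ring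
    have h3n : IsCoprime (3 : ℤ) n := hcmn.of_mul_left_left
    have hc3 : IsCoprime (-3 : ℤ) (-1 * u ^ 2 + w ^ 2) :=
      (h3n.pow_right (n := 2)).neg_left.of_isCoprime_of_dvd_right (Dvd.intro_left _ hn2)
    have hcop2 := isCoprime_sq_add_mul_sq (-1) (-3) hcuw.of_mul_left_right hc3
    have hw4 := Int.sq_emod_eight_of_odd hwodd
    obtain ⟨A, B, hA, hB⟩ | ⟨A, B, hA, hB⟩ := Int.exists_sq_and_sq_of_isCoprime hcop2 hn0
      (by rw [← hn2]; ring)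
    · have hueven : Even u := by
        rw [← Int.not_odd_iff_even]
        intro hu
        have h1 := Int.sq_emod_eight_of_odd hu
        have h2 : A ^ 2 % 8 = 1 := by
          refine Int.sq_emod_eight_of_odd ((Int.odd_pow' two_ne_zero).mp
            (show Odd (A ^ 2) from ?_))
          rw [← hA, Int.odd_iff]
          omega
        omega
      refine hu0 (ih B u A w ?_ ?_ hueven (by rw [← hB]; ring) (by rw [← hA, ← hB]; ring))
      · have : q = u * (2 * w * n) := by rw [hk, hmn, huw]; ring
        have h1 : q.natAbs = u.natAbs * (2 * w.natAbs * n.natAbs) := by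
          rw [this]; simp [Int.natAbs_mul]
        have h2 : 0 < w.natAbs := Int.natAbs_pos.mpr hw0
        have h3 : 0 < n.natAbs := Int.natAbs_pos.mpr hn0
        have h4 : 0 < u.natAbs := Int.natAbs_pos.mpr hu0
        have h5 : 2 ≤ 2 * w.natAbs * n.natAbs := by nlinarith
        nlinarith
      · refine (IsCoprime.pow_left_iff (m := 2) two_pos).mp ?_
        rw [← hB, show -1 * u ^ 2 + w ^ 2 = w ^ 2 + u * (-u) by ring]
        exact IsCoprime.add_mul_left_left hcuw.of_mul_left_right.symm.pow_left _
    · rcases Int.even_or_odd A with hA' | hA'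
      · have := Int.sq_emod_four_of_even hA'
        omega
      · have := Int.sq_emod_four_of_odd hA'
        omega

/-- `n² - m²` and `n² - 9m²` are not both squares for coprime `n`, `m` with `m` even and nonzero. -/
theorem eq_zero_of_sq_sub_sq_of_sq_sub_nine_mul_sq (N : ℕ) : ∀ n m c e : ℤ, m.natAbs ≤ N →
    IsCoprime n m → Even m → n ^ 2 - m ^ 2 = e ^ 2 → n ^ 2 - 9 * m ^ 2 = c ^ 2 → m = 0 := by
  induction N with
  | zero => intro n m c e hN _ _ _ _; omega
  | succ N ih =>
    intro n m c e hN hco hm he hc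
    by_contra hm0
    have hn : Odd n := by
      rw [← Int.not_even_iff_odd]
      intro hp
      exact Int.prime_two.not_isUnit (hco.isUnit_of_dvd' hp.two_dvd hm.two_dvd)
    have hn0 : n ≠ 0 := by rintro rfl; simp at hn
    have h3n : ¬ (3 : ℤ) ∣ n := by
      rintro ⟨k, rfl⟩
      have h3m : (3 : ℤ) ∣ m := by
        by_contra h
        have hm1 : m ^ 2 % 3 = 1 := by
          rcases (by omega : m % 3 = 1 ∨ m % 3 = 2) with h | h <;> simp [pow_two, Int.mul_emod, h]
        have he1 : e ^ 2 % 3 = 0 ∨ e ^ 2 % 3 = 1 := by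
          rcases (by omega : e % 3 = 0 ∨ e % 3 = 1 ∨ e % 3 = 2) with h | h | h <;>
            simp [pow_two, Int.mul_emod, h]
        have : (3 * k) ^ 2 = 3 * (3 * k ^ 2) := by ring
        omega
      exact Int.prime_three.not_isUnit (hco.isUnit_of_dvd' ⟨k, rfl⟩ h3m)
    have hm4 := Int.sq_emod_four_of_even hm
    have heodd : Odd e := by
      refine (Int.odd_pow' two_ne_zero).mp (show Odd (e ^ 2) from ?_)
      rw [← he]
      exact hn.pow.sub_even (hm.pow_of_ne_zero two_ne_zero)
    have hcem : IsCoprime e (2 * m) := by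
      refine IsCoprime.mul_right
        (Int.isCoprime_two_of_odd heodd).symm ?_
      refine (IsCoprime.pow_left_iff (m := 2) two_pos).mp ?_
      rw [← he, show n ^ 2 - m ^ 2 = n ^ 2 + m * (-m) by ring]
      exact IsCoprime.add_mul_left_left hco.pow_left _
    obtain ⟨u, w, huw, hcuw, heu, -⟩ := exists_param_sq_eq_sq_add (Y := c) Int.prime_two
      hm0 heodd hcem (by rw [← hc, ← he]; ring)
    have hu0 : u ≠ 0 := by rintro rfl; simp at huw; exact hm0 huw
    have hw0 : w ≠ 0 := by rintro rfl; simp at huw; exact hm0 huw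
    have hwodd : Odd w := by
      rw [← Int.not_even_iff_odd]
      intro hw
      exact Int.prime_two.not_isUnit (hcuw.isUnit_of_dvd' ⟨u, rfl⟩ hw.two_dvd)
    have hueven : Even u := by
      rw [huw, Int.even_mul] at hm
      exact hm.resolve_right (Int.not_even_iff_odd.mpr hwodd)
    have hn2 : (4 * u ^ 2 + w ^ 2) * (1 * u ^ 2 + w ^ 2) = n ^ 2 := by
      rw [show n ^ 2 = e ^ 2 + m ^ 2 by rw [← he]; ring, heu, huw]; ring
    have hc3 : IsCoprime (3 : ℤ) (1 * u ^ 2 + w ^ 2) :=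
      ((Int.isCoprime_three_of_not_dvd h3n).pow_right (n := 2)).of_isCoprime_of_dvd_right
        (Dvd.intro_left _ hn2)
    have hcuw' : IsCoprime u w := hcuw.of_mul_left_right
    have hcop2 := isCoprime_sq_add_mul_sq 1 3 hcuw' hc3
    have hu2 : 0 < u ^ 2 := by positivity
    obtain ⟨A, B, hA, hB⟩ | ⟨A, B, hA, hB⟩ := Int.exists_sq_and_sq_of_isCoprime hcop2 hn0
      (by rw [← hn2]; ring)
    swap
    · nlinarith [sq_nonneg w, sq_nonneg A]
    obtain ⟨k, hk⟩ := hueven.two_dvd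
    have hk0 : k ≠ 0 := by rintro rfl; exact hu0 (by simpa using hk)
    have hAodd : Odd A := by
      refine (Int.odd_pow' two_ne_zero).mp (show Odd (A ^ 2) from ?_)
      rw [← hA, show (1 + 3) * u ^ 2 + w ^ 2 = w ^ 2 + 2 * (2 * u ^ 2) by ring]
      exact hwodd.pow.add_even (even_two_mul _)
    have hc3A : IsCoprime A 3 := by
      refine (IsCoprime.pow_left_iff (m := 2) two_pos).mp ?_
      rw [← hA]
      exact (((Int.isCoprime_three_of_not_dvd h3n).pow_right (n := 2)).of_isCoprime_of_dvd_right
        (Dvd.intro _ hn2)).symm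
    have hcAu : IsCoprime A u := by
      refine (IsCoprime.pow_left_iff (m := 2) two_pos).mp ?_
      rw [← hA, show (1 + 3) * u ^ 2 + w ^ 2 = w ^ 2 + u * (4 * u) by ring]
      exact IsCoprime.add_mul_left_left hcuw'.symm.pow_left _
    obtain ⟨s, t, hst, hcst, hAs, hBs⟩ := exists_param_sq_eq_sq_add (Y := B) Int.prime_three
      hk0 hAodd
      (hc3A.mul_right (hcAu.of_isCoprime_of_dvd_right ⟨2, by rw [hk]; ring⟩))
      (by rw [← hA, ← hB, hk]; ring)
    have hs0 : s ≠ 0 := by rintro rfl; simp at hst; exact hk0 hst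
    have ht0 : t ≠ 0 := by rintro rfl; simp at hst; exact hk0 hst
    have hcst' : IsCoprime s t := hcst.of_mul_left_right
    have h3t : IsCoprime (3 : ℤ) t := hcst.of_mul_left_left
    have hodd : Odd (3 * s ^ 2 + t ^ 2) := (Int.odd_pow' two_ne_zero).mp (hAs ▸ hAodd.pow)
    have hodd' : Odd (-1 * s ^ 2 + t ^ 2) := by
      rw [show -1 * s ^ 2 + t ^ 2 = 3 * s ^ 2 + t ^ 2 - 2 * (2 * s ^ 2) by ring]
      exact hodd.sub_even (even_two_mul _)
    have hw2 : ((-1 + -8) * s ^ 2 + t ^ 2) * (-1 * s ^ 2 + t ^ 2) = w ^ 2 := by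
      rw [show w ^ 2 = B ^ 2 - u ^ 2 by rw [← hB]; ring, hBs, hk, hst]; ring
    have hc8 : IsCoprime (-8 : ℤ) (-1 * s ^ 2 + t ^ 2) :=
      ((Int.isCoprime_two_of_odd hodd').pow_left
        (m := 3)).neg_left
    have hcop3 := isCoprime_sq_add_mul_sq (-1) (-8) hcst' hc8
    obtain ⟨C, E, hC, hE⟩ | ⟨C, E, hC, hE⟩ := Int.exists_sq_and_sq_of_isCoprime hcop3 hw0 hw2
    · have hseven : Even s := by
        rw [← Int.not_odd_iff_even]
        intro hs
        have h1 := Int.sq_emod_four_of_odd hs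
        rw [Int.odd_iff] at hodd'
        have h2 : t ^ 2 % 4 = 0 := by
          rcases Int.even_or_odd t with ht | ht
          · exact Int.sq_emod_four_of_even ht
          · have := Int.sq_emod_four_of_odd ht
            omega
        rcases Int.even_or_odd E with hE' | hE'
        · have := Int.sq_emod_four_of_even hE'
          omega
        · have := Int.sq_emod_four_of_odd hE'
          omega
      refine hs0 (ih t s C E ?_ hcst'.symm hseven (by rw [← hE]; ring) (by rw [← hC]; ring))
      have : m = s * (2 * t * w) := by rw [huw, hk, hst]; ring
      have h1 : m.natAbs = s.natAbs * (2 * t.natAbs * w.natAbs) := by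
        rw [this]; simp [Int.natAbs_mul]
      have h2 : 0 < w.natAbs := Int.natAbs_pos.mpr hw0
      have h3 : 0 < t.natAbs := Int.natAbs_pos.mpr ht0
      have h4 : 0 < s.natAbs := Int.natAbs_pos.mpr hs0
      have h5 : 2 ≤ 2 * t.natAbs * w.natAbs := by nlinarith
      nlinarith
    · have hEodd : E ^ 2 % 4 = 1 := by
        refine Int.sq_emod_four_of_odd ((Int.odd_pow' two_ne_zero).mp (show Odd (E ^ 2) from ?_))
        rw [← neg_neg (E ^ 2), ← hE]
        exact hodd'.neg
      have hsodd : Odd s := by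
        rw [← Int.not_even_iff_odd]
        intro hs
        have h1 := Int.sq_emod_four_of_even hs
        rcases Int.even_or_odd t with ht | ht
        · have := Int.sq_emod_four_of_even ht
          omega
        · have := Int.sq_emod_four_of_odd ht
          omega
      have hCodd : Odd C := by
        refine (Int.odd_pow' two_ne_zero).mp (show Odd (C ^ 2) from ?_)
        rw [← neg_neg (C ^ 2), ← hC, show (-1 + -8) * s ^ 2 + t ^ 2 =
          -1 * s ^ 2 + t ^ 2 - 2 * (4 * s ^ 2) by ring]
        exact (hodd'.sub_even (even_two_mul _)).neg
      have hcCs : IsCoprime C (2 * s) := by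
        refine IsCoprime.mul_right
          (Int.isCoprime_two_of_odd hCodd).symm ?_
        refine (IsCoprime.pow_left_iff (m := 2) two_pos).mp ?_
        rw [← neg_neg (C ^ 2), ← hC,
          show -((-1 + -8) * s ^ 2 + t ^ 2) = -t ^ 2 + s * (9 * s) by ring]
        exact IsCoprime.add_mul_left_left hcst'.symm.pow_left.neg_left _
      obtain ⟨f, g, hfg, hcfg, -, hEf⟩ := exists_param_sq_eq_sq_add (Y := E) Int.prime_two
        hs0 hCodd hcCs (by linarith)
      rw [hfg, Int.odd_mul] at hsodd
      have hf4 := Int.sq_emod_four_of_odd hsodd.1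
      have hg4 := Int.sq_emod_four_of_odd hsodd.2
      have ht2 : (-4 * f ^ 2 + g ^ 2) * (-1 * f ^ 2 + g ^ 2) = -t ^ 2 := by
        rw [show t ^ 2 = s ^ 2 - E ^ 2 by linarith, hEf, hfg]; ring
      have hc3' : IsCoprime (-3 : ℤ) (-1 * f ^ 2 + g ^ 2) :=
        ((h3t.pow_right (n := 2)).neg_left.neg_right).of_isCoprime_of_dvd_right
          (Dvd.intro_left _ ht2)
      have hcop4 := (isCoprime_sq_add_mul_sq (-1) (-3) hcfg.of_mul_left_right hc3').neg_left
      obtain ⟨P, Q, hP, hQ⟩ | ⟨P, Q, hP, hQ⟩ := Int.exists_sq_and_sq_of_isCoprime hcop4 ht0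
        (by linear_combination -ht2)
      · rcases Int.even_or_odd P with hP' | hP'
        · have := Int.sq_emod_four_of_even hP'
          omega
        · have := Int.sq_emod_four_of_odd hP'
          omega
      · have h1 := sq_nonneg P
        have h2 := sq_nonneg Q
        have h3 := sq_nonneg f
        omega

/-- The rational points of `y² = -(x² - 3)(x² + 1)` have `x = ±1`. -/
theorem sq_eq_of_neg_mul_eq_sq {p q Y : ℤ} (hco : IsCoprime p q)
    (h : -(p ^ 2 - 3 * q ^ 2) * (p ^ 2 + q ^ 2) = Y ^ 2) : p ^ 2 = q ^ 2 := by
  have hY4 : Y ^ 2 % 4 = 0 ∨ Y ^ 2 % 4 = 1 := by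
    rcases Int.even_or_odd Y with h | h
    · exact Or.inl (Int.sq_emod_four_of_even h)
    · exact Or.inr (Int.sq_emod_four_of_odd h)
  have hmod : (-(p ^ 2 - 3 * q ^ 2) * (p ^ 2 + q ^ 2)) % 4 =
      (-(p ^ 2 % 4 - 3 * (q ^ 2 % 4)) * (p ^ 2 % 4 + q ^ 2 % 4)) % 4 := by
    simp [Int.mul_emod, Int.add_emod, Int.sub_emod]
  have hpq : Odd p ∧ Odd q := by
    rcases Int.even_or_odd p with hp | hp <;> rcases Int.even_or_odd q with hq | hq
    · exact absurd (hco.isUnit_of_dvd' hp.two_dvd hq.two_dvd) Int.prime_two.not_isUnit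
    · rw [Int.sq_emod_four_of_even hp, Int.sq_emod_four_of_odd hq, h] at hmod
      omega
    · rw [Int.sq_emod_four_of_odd hp, Int.sq_emod_four_of_even hq, h] at hmod
      omega
    · exact ⟨hp, hq⟩
  obtain ⟨hp, hq⟩ := hpq
  have hp8 := Int.sq_emod_eight_of_odd hp
  have hq8 := Int.sq_emod_eight_of_odd hq
  obtain ⟨t, ht⟩ : ∃ t, q ^ 2 - p ^ 2 = 4 * t := ⟨(q ^ 2 - p ^ 2) / 4, by omega⟩
  have hteven : Even t := by rw [Int.even_iff]; omega
  -- `p²`, `q² - 2t`, `q²`, `q² + 2t` is an arithmetic progression of squares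
  have hYeven : Even Y := by
    rw [← Int.not_odd_iff_even]
    intro hY
    have := Int.sq_emod_four_of_odd hY
    rw [Int.sq_emod_four_of_odd hp, Int.sq_emod_four_of_odd hq, h] at hmod
    omega
  obtain ⟨y, hy⟩ := hYeven.two_dvd
  have hprod : (q ^ 2 + 2 * t) * (q ^ 2 - 2 * t) = y ^ 2 := by
    have h4 : 4 * ((q ^ 2 + 2 * t) * (q ^ 2 - 2 * t)) = 4 * y ^ 2 := by
      rw [show p ^ 2 = q ^ 2 - 4 * t by linarith, hy] at h
      linear_combination h
    linarith
  have hodd : Odd (q ^ 2 - 2 * t) := hq.pow.sub_even (even_two_mul _)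
  have hcqt : IsCoprime q t := by
    have h1 : IsCoprime (q ^ 2) (p ^ 2) := hco.symm.pow
    rw [show p ^ 2 = -(4 * t) + q ^ 2 * 1 by linarith] at h1
    have h2 := (IsCoprime.add_mul_left_right_iff.mp h1).neg_right
    rw [neg_neg] at h2
    exact ((IsCoprime.pow_left_iff two_pos).mp h2).of_mul_right_right
  have hcop : IsCoprime (q ^ 2 + 2 * t) (q ^ 2 - 2 * t) := by
    have h1 : IsCoprime (4 : ℤ) (q ^ 2 - 2 * t) :=
      (Int.isCoprime_two_of_odd hodd).pow_left (m := 2)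
    have h2 : IsCoprime t (q ^ 2 - 2 * t) := by
      rw [show q ^ 2 - 2 * t = q ^ 2 + t * (-2) by ring]
      exact IsCoprime.add_mul_left_right_iff.mpr hcqt.symm.pow_right
    rw [show q ^ 2 + 2 * t = 4 * t + (q ^ 2 - 2 * t) * 1 by ring]
    exact IsCoprime.add_mul_left_left (h1.mul_left h2) 1
  have hy0 : y ≠ 0 := by
    rintro rfl
    rcases mul_eq_zero.mp (hprod.trans (by norm_num)) with h0 | h0 <;> omega
  obtain ⟨u, v, hu, hv⟩ | ⟨u, v, hu, hv⟩ := Int.exists_sq_and_sq_of_isCoprime hcop hy0 hprod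
  swap
  · have h1 := sq_nonneg u
    have h2 := sq_nonneg v
    have h3 := sq_nonneg q
    omega
  have ht0 : t = 0 := by
    refine eq_zero_of_sq_sub_sq_of_sq_sub_nine_mul_sq _ (q ^ 2 - t) t (p * u) (v * q) le_rfl
      ?_ hteven ?_ ?_
    · rw [show q ^ 2 - t = q ^ 2 + t * (-1) by ring]
      exact IsCoprime.add_mul_left_left hcqt.pow_left _
    · rw [mul_pow, ← hv]; ring
    · rw [mul_pow, ← hu, show p ^ 2 = q ^ 2 - 4 * t by linarith]; ring
  linarith

/-- The curve `y² = (x² - 3)(x² + 1)` has no affine rational point. -/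
theorem eq_zero_of_mul_eq_sq {p q Y : ℤ} (hco : IsCoprime p q)
    (h : (p ^ 2 - 3 * q ^ 2) * (p ^ 2 + q ^ 2) = Y ^ 2) : q = 0 := by
  by_contra hq0
  have hq2 : 0 < q ^ 2 := by positivity
  have hsq (a : ℤ) : a ^ 2 % 16 = 0 ∨ a ^ 2 % 16 = 1 ∨ a ^ 2 % 16 = 4 ∨ a ^ 2 % 16 = 9 := by
    have : a ^ 2 % 16 = (a % 16) ^ 2 % 16 := by simp [pow_two, Int.mul_emod]
    have h1 : 0 ≤ a % 16 := by omega
    have h2 : a % 16 < 16 := by omega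
    generalize a % 16 = b at *
    interval_cases b <;> simp_all
  have hmod : ((p ^ 2 - 3 * q ^ 2) * (p ^ 2 + q ^ 2)) % 16 =
      ((p ^ 2 % 16 - 3 * (q ^ 2 % 16)) * (p ^ 2 % 16 + q ^ 2 % 16)) % 16 := by
    simp [Int.mul_emod, Int.add_emod, Int.sub_emod]
  rw [h] at hmod
  have hqe : Even q := by
    rw [← Int.not_odd_iff_even]
    intro hq
    have hq8 := Int.sq_emod_eight_of_odd hq
    rcases hsq p with h1 | h1 | h1 | h1 <;> rcases hsq q with h2 | h2 | h2 | h2 <;>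
      rw [h1, h2] at hmod <;> rcases hsq Y with h3 | h3 | h3 | h3 <;> omega
  have hp : Odd p := by
    rw [← Int.not_even_iff_odd]
    intro hp
    exact Int.prime_two.not_isUnit (hco.isUnit_of_dvd' hp.two_dvd hqe.two_dvd)
  have hodd : Odd (p ^ 2 + q ^ 2) := hp.pow.add_even (hqe.pow_of_ne_zero two_ne_zero)
  have hcop : IsCoprime (p ^ 2 - 3 * q ^ 2) (p ^ 2 + q ^ 2) := by
    have h1 : IsCoprime (-4 : ℤ) (p ^ 2 + q ^ 2) :=
      ((Int.isCoprime_two_of_odd hodd).pow_left (m := 2)).neg_left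
    have h2 : IsCoprime (q ^ 2) (p ^ 2 + q ^ 2) := by
      rw [show p ^ 2 + q ^ 2 = p ^ 2 + q ^ 2 * 1 by ring]
      exact IsCoprime.add_mul_left_right_iff.mpr hco.symm.pow
    rw [show p ^ 2 - 3 * q ^ 2 = -4 * q ^ 2 + (p ^ 2 + q ^ 2) * 1 by ring]
    exact IsCoprime.add_mul_left_left (h1.mul_left h2) 1
  have hY0 : Y ≠ 0 := by
    rintro rfl
    have h1 := hp.pow (n := 2)
    have h2 := hqe.pow_of_ne_zero (n := 2) two_ne_zero
    rw [Int.odd_iff] at h1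
    rw [Int.even_iff] at h2
    rcases mul_eq_zero.mp (h.trans (by norm_num)) with h0 | h0 <;> omega
  obtain ⟨a, b, ha, hb⟩ | ⟨a, b, ha, hb⟩ := Int.exists_sq_and_sq_of_isCoprime hcop hY0 h
  · exact hq0 (eq_zero_of_sq_add_sq_of_sq_sub_three_mul_sq _ p q a b le_rfl hco hqe hb ha)
  · nlinarith [sq_nonneg p, sq_nonneg b]

theorem isCoprime_of_dvd_sq_sub_three_mul_sq {p q d : ℤ} (hco : IsCoprime p q) (hd : Odd d)
    (h : d ∣ p ^ 2 - 3 * q ^ 2) :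
    IsCoprime d (-2 * q * (p ^ 3 - p ^ 2 * q - p * q ^ 2 - q ^ 3)) := by
  have h2 : IsCoprime d 2 := (Int.isCoprime_two_of_odd hd).symm
  have hq : IsCoprime d q := by
    refine IsCoprime.of_isCoprime_of_dvd_left ?_ h
    rw [show p ^ 2 - 3 * q ^ 2 = p ^ 2 + q * (-3 * q) by ring]
    exact IsCoprime.add_mul_left_left hco.pow_left _
  obtain ⟨k, hk⟩ := h
  refine (h2.neg_right.mul_right hq).mul_right ?_
  have h3 : IsCoprime d (-2 * q ^ 4) := h2.neg_right.mul_right hq.pow_right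
  rw [show -2 * q ^ 4 = (p + 2 * q) * (p ^ 3 - p ^ 2 * q - p * q ^ 2 - q ^ 3) +
    d * (-k * (p ^ 2 + p * q)) by
      linear_combination -(p ^ 2 + p * q) * hk] at h3
  exact (IsCoprime.add_mul_left_right_iff.mp h3).of_mul_right_right

theorem isCoprime_of_dvd_sq_add_sq {p q d : ℤ} (hco : IsCoprime p q) (hd : Odd d)
    (h : d ∣ p ^ 2 + q ^ 2) :
    IsCoprime d (-2 * q * (p ^ 3 - p ^ 2 * q - p * q ^ 2 - q ^ 3)) := by
  have h2 : IsCoprime d 2 := (Int.isCoprime_two_of_odd hd).symm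
  have hq : IsCoprime d q := by
    refine IsCoprime.of_isCoprime_of_dvd_left ?_ h
    rw [show p ^ 2 + q ^ 2 = p ^ 2 + q * q by ring]
    exact IsCoprime.add_mul_left_left hco.pow_left _
  have hp : IsCoprime d p := by
    refine IsCoprime.of_isCoprime_of_dvd_left ?_ h
    rw [show p ^ 2 + q ^ 2 = q ^ 2 + p * p by ring]
    exact IsCoprime.add_mul_left_left hco.symm.pow_left _
  obtain ⟨k, hk⟩ := h
  refine (h2.neg_right.mul_right hq).mul_right ?_
  have h3 : IsCoprime d (-2 * p * q ^ 2) := (h2.neg_right.mul_right hp).mul_right hq.pow_right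
  rw [show -2 * p * q ^ 2 = (p ^ 3 - p ^ 2 * q - p * q ^ 2 - q ^ 3) + d * (-k * (p - q)) by
      linear_combination -(p - q) * hk] at h3
  exact IsCoprime.add_mul_left_right_iff.mp h3

/-- If the product of the two right-hand sides is a square, the first one is a square up to sign. -/
theorem exists_sq_of_mul_eq_sq {p q W : ℤ} (hco : IsCoprime p q)
    (h : (-(p ^ 2 - 3 * q ^ 2) * (p ^ 2 + q ^ 2)) *
      (-2 * q * (p ^ 3 - p ^ 2 * q - p * q ^ 2 - q ^ 3)) = W ^ 2) :
    ∃ Y : ℤ, -(p ^ 2 - 3 * q ^ 2) * (p ^ 2 + q ^ 2) = Y ^ 2 ∨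
      -(p ^ 2 - 3 * q ^ 2) * (p ^ 2 + q ^ 2) = -Y ^ 2 := by
  by_cases hpq : Odd p ∧ Odd q
  · obtain ⟨hp, hq⟩ := hpq
    have hp8 := Int.sq_emod_eight_of_odd hp
    have hq8 := Int.sq_emod_eight_of_odd hq
    obtain ⟨u, hu⟩ : ∃ u, p ^ 2 - 3 * q ^ 2 = 2 * u := ⟨(p ^ 2 - 3 * q ^ 2) / 2, by omega⟩
    obtain ⟨v, hv⟩ : ∃ v, p ^ 2 + q ^ 2 = 2 * v := ⟨(p ^ 2 + q ^ 2) / 2, by omega⟩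
    have hc1 := isCoprime_of_dvd_sq_sub_three_mul_sq (d := u) hco (by rw [Int.odd_iff]; omega)
      ⟨2, by rw [hu]; ring⟩
    have hc2 := isCoprime_of_dvd_sq_add_sq (d := v) hco (by rw [Int.odd_iff]; omega)
      ⟨2, by rw [hv]; ring⟩
    have hWe : Even W := by
      have : Even (W ^ 2) := by rw [← h, hu]; exact ⟨-u * (p ^ 2 + q ^ 2) *
        (-2 * q * (p ^ 3 - p ^ 2 * q - p * q ^ 2 - q ^ 3)), by ring⟩
      exact (Int.even_pow' two_ne_zero).mp this
    obtain ⟨w, hw⟩ := hWe.two_dvd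
    obtain ⟨Y, hY⟩ := Int.sq_of_isCoprime (c := w) (hc1.mul_left hc2).neg_left (by
      rw [hu, hv, hw] at h
      linarith)
    refine ⟨2 * Y, ?_⟩
    rw [hu, hv]
    rcases hY with hY | hY
    · exact Or.inl (by linear_combination 4 * hY)
    · exact Or.inr (by linear_combination 4 * hY)
  · have hodd : Odd (p ^ 2 + q ^ 2) ∧ Odd (p ^ 2 - 3 * q ^ 2) := by
      rcases Int.even_or_odd p with hp | hp <;> rcases Int.even_or_odd q with hq | hq
      · exact absurd (hco.isUnit_of_dvd' hp.two_dvd hq.two_dvd) Int.prime_two.not_isUnit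
      · have h1 := Int.sq_emod_four_of_even hp
        have h2 := Int.sq_emod_four_of_odd hq
        constructor <;> rw [Int.odd_iff] <;> omega
      · have h1 := Int.sq_emod_four_of_odd hp
        have h2 := Int.sq_emod_four_of_even hq
        constructor <;> rw [Int.odd_iff] <;> omega
      · exact absurd ⟨hp, hq⟩ hpq
    exact Int.sq_of_isCoprime
      ((isCoprime_of_dvd_sq_sub_three_mul_sq hco hodd.2 dvd_rfl).neg_left.mul_left
        (isCoprime_of_dvd_sq_add_sq hco hodd.1 dvd_rfl)) h

theorem Rat.exists_int_sq {a : ℤ} {r : ℚ} (h : (a : ℚ) = r ^ 2) :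
    ∃ b : ℤ, a = b ^ 2 ∧ (b : ℚ) = r := by
  have hr : IsIntegral ℤ r :=
    IsIntegral.of_pow two_pos (by rw [← h]; exact isIntegral_algebraMap (R := ℤ) (x := a))
  obtain ⟨b, hb⟩ := IsIntegrallyClosed.isIntegral_iff.mp hr
  have hb' : (b : ℚ) = r := by simpa using hb
  exact ⟨b, by exact_mod_cast (by rw [h, hb'] : (a : ℚ) = (b : ℚ) ^ 2), hb'⟩

theorem Rat.eq_one_or_neg_one_of_num_sq_eq {x : ℚ} (h : x.num ^ 2 = (x.den : ℤ) ^ 2) :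
    x = 1 ∨ x = -1 := by
  have hd : (x.den : ℚ) ≠ 0 := by exact_mod_cast x.den_ne_zero
  have h' : (x.num : ℚ) ^ 2 = (x.den : ℚ) ^ 2 := by exact_mod_cast h
  rw [← sq_eq_one_iff, ← Rat.num_div_den x, div_pow, h', div_self (pow_ne_zero 2 hd)]

theorem eq_one_or_neg_one_of_rat_quartic {x y : ℚ}
    (h : y ^ 2 = -(x ^ 2 - 3) * (x ^ 2 + 1)) : x = 1 ∨ x = -1 := by
  have hd : (x.den : ℚ) ≠ 0 := by exact_mod_cast x.den_ne_zero
  have hx : x * x.den = x.num := Rat.mul_den_eq_num x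
  obtain ⟨Y, hY, -⟩ := Rat.exists_int_sq
    (a := -(x.num ^ 2 - 3 * (x.den : ℤ) ^ 2) * (x.num ^ 2 + (x.den : ℤ) ^ 2))
    (r := y * (x.den : ℚ) ^ 2) (by
      push_cast
      rw [← hx]
      linear_combination -(x.den : ℚ) ^ 4 * h)
  exact Rat.eq_one_or_neg_one_of_num_sq_eq (sq_eq_of_neg_mul_eq_sq (Rat.isCoprime_num_den x) hY)

theorem eq_one_or_neg_one_of_rat_product {x w : ℚ}
    (h : w ^ 2 = -(x ^ 2 - 3) * (x ^ 2 + 1) * (-2 * (x ^ 3 - x ^ 2 - x - 1))) :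
    x = 1 ∨ x = -1 := by
  have hx : x * x.den = x.num := Rat.mul_den_eq_num x
  have hco := Rat.isCoprime_num_den x
  obtain ⟨W, hW, -⟩ := Rat.exists_int_sq
    (a := (-(x.num ^ 2 - 3 * (x.den : ℤ) ^ 2) * (x.num ^ 2 + (x.den : ℤ) ^ 2)) *
      (-2 * (x.den : ℤ) * (x.num ^ 3 - x.num ^ 2 * (x.den : ℤ) - x.num * (x.den : ℤ) ^ 2 -
        (x.den : ℤ) ^ 3)))
    (r := w * (x.den : ℚ) ^ 4) (by
      push_cast
      rw [← hx]
      linear_combination -(x.den : ℚ) ^ 8 * h)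
  obtain ⟨Y, hY | hY⟩ := exists_sq_of_mul_eq_sq hco hW
  · exact Rat.eq_one_or_neg_one_of_num_sq_eq (sq_eq_of_neg_mul_eq_sq hco hY)
  · have := eq_zero_of_mul_eq_sq hco (Y := Y) (by linear_combination -hY)
    exact absurd this (by exact_mod_cast x.den_ne_zero)

section Tribonacci

open NumberField

theorem tribonacci_isIntegral {L : Type*} [Field L] {θ : L} (hθ : θ ^ 3 = θ ^ 2 + θ + 1) :
    IsIntegral ℤ θ :=
  ⟨Polynomial.X ^ 3 - Polynomial.X ^ 2 - Polynomial.X - 1, by monicity!, by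
    simp only [Polynomial.eval₂_sub, Polynomial.eval₂_pow, Polynomial.eval₂_X,
      Polynomial.eval₂_one]
    linear_combination hθ⟩

variable {L : Type*} [Field L] [NumberField L] {θ : L}

theorem tribonacci_repr (B : Module.Basis (Fin 3) ℚ L) (hB : ∀ i, B i = θ ^ (i : ℕ)) (a b c : ℚ) :
    ⇑(B.repr ((a : L) + b * θ + c * θ ^ 2)) = ![a, b, c] := by
  have h : (a : L) + b * θ + c * θ ^ 2 = ∑ i, (![a, b, c] : Fin 3 → ℚ) i • B i := by
    simp [Fin.sum_univ_three, hB, Rat.smul_def]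
  rw [h, Module.Basis.repr_sum_self]

theorem tribonacci_exists_coords (B : Module.Basis (Fin 3) ℚ L) (hB : ∀ i, B i = θ ^ (i : ℕ))
    (α : L) : ∃ a b c : ℚ, α = (a : L) + b * θ + c * θ ^ 2 :=
  ⟨B.repr α 0, B.repr α 1, B.repr α 2, by
    conv_lhs => rw [← B.sum_repr α]
    simp [Fin.sum_univ_three, hB, Rat.smul_def]⟩

theorem tribonacci_coords_ext (B : Module.Basis (Fin 3) ℚ L) (hB : ∀ i, B i = θ ^ (i : ℕ))
    {a b c a' b' c' : ℚ}
    (h : (a : L) + b * θ + c * θ ^ 2 = (a' : L) + b' * θ + c' * θ ^ 2) :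
    a = a' ∧ b = b' ∧ c = c' := by
  have h1 := tribonacci_repr B hB a b c
  rw [h, tribonacci_repr B hB a' b' c'] at h1
  exact ⟨(congrFun h1 0).symm, (congrFun h1 1).symm, (congrFun h1 2).symm⟩

theorem tribonacci_leftMulMatrix (hθ : θ ^ 3 = θ ^ 2 + θ + 1) (B : Module.Basis (Fin 3) ℚ L)
    (hB : ∀ i, B i = θ ^ (i : ℕ)) (a b c : ℚ) :
    Algebra.leftMulMatrix B ((a : L) + b * θ + c * θ ^ 2) =
      !![a, c, b + c; b, a + c, b + 2 * c; c, b + c, a + b + 2 * c] := by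
  have h0 : ((a : L) + b * θ + c * θ ^ 2) * B 0 = (a : L) + b * θ + c * θ ^ 2 := by simp [hB]
  have h1 : ((a : L) + b * θ + c * θ ^ 2) * B 1 =
      (c : ℚ) + ((a + c : ℚ) : L) * θ + ((b + c : ℚ) : L) * θ ^ 2 := by
    simp only [hB, Fin.val_one, pow_one]
    push_cast
    linear_combination (c : L) * hθ
  have h2 : ((a : L) + b * θ + c * θ ^ 2) * B 2 =
      ((b + c : ℚ) : L) + ((b + 2 * c : ℚ) : L) * θ + ((a + b + 2 * c : ℚ) : L) * θ ^ 2 := by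
    simp only [hB, Fin.val_two]
    push_cast
    linear_combination ((b : L) + c * (θ + 1)) * hθ
  ext i j
  rw [Algebra.leftMulMatrix_eq_repr_mul]
  fin_cases j
  · rw [show (⟨0, by norm_num⟩ : Fin 3) = 0 from rfl, h0, tribonacci_repr B hB]
    fin_cases i <;> rfl
  · rw [show (⟨1, by norm_num⟩ : Fin 3) = 1 from rfl, h1, tribonacci_repr B hB]
    fin_cases i <;> rfl
  · rw [show (⟨2, by norm_num⟩ : Fin 3) = 2 from rfl, h2, tribonacci_repr B hB]
    fin_cases i <;> rfl

theorem tribonacci_norm (hθ : θ ^ 3 = θ ^ 2 + θ + 1) (B : Module.Basis (Fin 3) ℚ L)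
    (hB : ∀ i, B i = θ ^ (i : ℕ)) (a b c : ℚ) :
    Algebra.norm ℚ ((a : L) + b * θ + c * θ ^ 2) =
      a * ((a + c) * (a + b + 2 * c) - (b + 2 * c) * (b + c)) -
      c * (b * (a + b + 2 * c) - (b + 2 * c) * c) + (b + c) * (b * (b + c) - (a + c) * c) := by
  rw [Algebra.norm_eq_matrix_det B, tribonacci_leftMulMatrix hθ B hB, Matrix.det_fin_three]
  simp
  ring

theorem tribonacci_trace (hθ : θ ^ 3 = θ ^ 2 + θ + 1) (B : Module.Basis (Fin 3) ℚ L)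
    (hB : ∀ i, B i = θ ^ (i : ℕ)) (a b c : ℚ) :
    Algebra.trace ℚ L ((a : L) + b * θ + c * θ ^ 2) = 3 * a + b + 3 * c := by
  rw [Algebra.trace_eq_matrix_trace B, tribonacci_leftMulMatrix hθ B hB, Matrix.trace_fin_three]
  simp
  ring

theorem tribonacci_trace_pow (hθ : θ ^ 3 = θ ^ 2 + θ + 1) (B : Module.Basis (Fin 3) ℚ L)
    (hB : ∀ i, B i = θ ^ (i : ℕ)) (i j : Fin 3) :
    Algebra.trace ℚ L (θ ^ (i : ℕ) * θ ^ (j : ℕ)) = !![3, 1, 3; 1, 3, 7; 3, 7, 11] i j := by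
  have h (x : L) (a b c : ℚ) (h : x = (a : L) + b * θ + c * θ ^ 2) :
      Algebra.trace ℚ L x = 3 * a + b + 3 * c := by rw [h, tribonacci_trace hθ B hB]
  have h0 := h 1 1 0 0 (by simp)
  have h1 := h θ 0 1 0 (by simp)
  have h2 := h (θ ^ 2) 0 0 1 (by simp)
  have h3 := h (θ ^ 3) 1 1 1 (by push_cast; linear_combination hθ)
  have h4 := h (θ ^ 4) 1 2 2 (by push_cast; linear_combination (θ + 1) * hθ)
  norm_num at h0 h1 h2 h3 h4
  rw [← pow_add]
  fin_cases i <;> fin_cases j <;> simp [h0, h1, h2, h3, h4]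

theorem tribonacci_finrank (B : Module.Basis (Fin 3) ℚ L) : Module.finrank ℚ L = 3 := by
  simp [Module.finrank_eq_card_basis B]

theorem tribonacci_discr (hθ : θ ^ 3 = θ ^ 2 + θ + 1) (B : Module.Basis (Fin 3) ℚ L)
    (hB : ∀ i, B i = θ ^ (i : ℕ)) : ∃ d : ℤ, -44 = d ^ 2 * discr L := by
  have hcard : Fintype.card (Module.Free.ChooseBasisIndex ℤ (𝓞 L)) = 3 := by
    rw [← Module.finrank_eq_card_chooseBasisIndex, RingOfIntegers.rank, tribonacci_finrank B]
  let b : Module.Basis (Fin 3) ℤ (𝓞 L) :=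
    (RingOfIntegers.basis L).reindex (Fintype.equivFinOfCardEq hcard)
  let t : 𝓞 L := ⟨θ, tribonacci_isIntegral hθ⟩
  let v : Fin 3 → 𝓞 L := fun i => t ^ (i : ℕ)
  have hv : v = Matrix.vecMul b ((b.toMatrix v).map (algebraMap ℤ (𝓞 L))) := by
    ext1 j
    rw [Matrix.vecMul, dotProduct]
    conv_lhs => rw [← b.sum_repr (v j)]
    refine Finset.sum_congr rfl fun i _ => ?_
    simp [Module.Basis.toMatrix_apply, mul_comm]
  refine ⟨(b.toMatrix v).det, ?_⟩
  rw [← discr_eq_discr L b, ← Algebra.discr_of_matrix_vecMul, ← hv, Algebra.discr_def]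
  have hM : Algebra.traceMatrix ℤ v = !![3, 1, 3; 1, 3, 7; 3, 7, 11] := by
    ext i j
    rw [Algebra.traceMatrix_apply, Algebra.traceForm_apply]
    have h1 := Algebra.coe_trace_int (v i * v j)
    have h2 := tribonacci_trace_pow hθ B hB i j
    have ht : (t : L) = θ := rfl
    have h3 : ((v i * v j : 𝓞 L) : L) = θ ^ (i : ℕ) * θ ^ (j : ℕ) := by
      simp only [v, map_mul, map_pow, ht]
    rw [h3, h2] at h1
    have h4 : (((!![3, 1, 3; 1, 3, 7; 3, 7, 11] : Matrix (Fin 3) (Fin 3) ℤ) i j : ℤ) : ℚ) =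
        (!![3, 1, 3; 1, 3, 7; 3, 7, 11] : Matrix (Fin 3) (Fin 3) ℚ) i j := by
      fin_cases i <;> fin_cases j <;> simp
    rw [← h4] at h1
    exact_mod_cast h1
  rw [hM, Matrix.det_fin_three]
  simp

theorem tribonacci_discr_bounds (hθ : θ ^ 3 = θ ^ 2 + θ + 1) (B : Module.Basis (Fin 3) ℚ L)
    (hB : ∀ i, B i = θ ^ (i : ℕ)) : -44 ≤ discr L ∧ discr L < 0 := by
  obtain ⟨d, hd⟩ := tribonacci_discr hθ B hB
  have hd0 : 0 < d ^ 2 := by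
    refine lt_of_le_of_ne (sq_nonneg d) fun h => ?_
    rw [← h] at hd
    omega
  constructor <;> nlinarith

theorem tribonacci_nrComplexPlaces (hθ : θ ^ 3 = θ ^ 2 + θ + 1) (B : Module.Basis (Fin 3) ℚ L)
    (hB : ∀ i, B i = θ ^ (i : ℕ)) : InfinitePlace.nrComplexPlaces L = 1 := by
  have h1 := InfinitePlace.card_add_two_mul_card_eq_rank L
  rw [tribonacci_finrank B] at h1
  have h2 := sign_discr L
  rw [Int.sign_eq_neg_one_of_neg (tribonacci_discr_bounds hθ B hB).2] at h2
  have h3 : InfinitePlace.nrComplexPlaces L ≤ 1 := by omega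
  interval_cases InfinitePlace.nrComplexPlaces L
  · norm_num at h2
  · rfl

theorem tribonacci_isPrincipalIdealRing (hθ : θ ^ 3 = θ ^ 2 + θ + 1)
    (B : Module.Basis (Fin 3) ℚ L) (hB : ∀ i, B i = θ ^ (i : ℕ)) :
    IsPrincipalIdealRing (𝓞 L) := by
  apply RingOfIntegers.isPrincipalIdealRing_of_abs_discr_lt
  rw [tribonacci_nrComplexPlaces hθ B hB, tribonacci_finrank B]
  obtain ⟨h1, h2⟩ := tribonacci_discr_bounds hθ B hB
  have h3 : ((|discr L| : ℤ) : ℝ) ≤ 44 := by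
    rw [abs_of_neg h2]
    exact_mod_cast (by linarith : -discr L ≤ 44)
  refine lt_of_le_of_lt h3 ?_
  norm_num [Nat.factorial]
  nlinarith [Real.pi_gt_d2]

theorem tribonacci_unit_rank (hθ : θ ^ 3 = θ ^ 2 + θ + 1) (B : Module.Basis (Fin 3) ℚ L)
    (hB : ∀ i, B i = θ ^ (i : ℕ)) : Units.rank L = 1 := by
  have h1 := InfinitePlace.card_add_two_mul_card_eq_rank L
  have h2 := InfinitePlace.card_eq_nrRealPlaces_add_nrComplexPlaces L
  rw [tribonacci_nrComplexPlaces hθ B hB] at h1 h2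
  rw [tribonacci_finrank B] at h1
  rw [Units.rank]
  omega

end Tribonacci

theorem exists_eq_squarefree_mul_sq {R : Type*} [CommRing R] [IsDomain R]
    [UniqueFactorizationMonoid R] {x : R} (hx : x ≠ 0) :
    ∃ r s : R, x = r * s ^ 2 ∧ Squarefree r := by
  induction x using UniqueFactorizationMonoid.induction_on_prime with
  | h₁ => exact absurd rfl hx
  | h₂ u hu => exact ⟨u, 1, by ring, hu.squarefree⟩
  | h₃ a p ha hp ih =>
    obtain ⟨r, s, rfl, hr⟩ := ih ha
    by_cases hpr : p ∣ r
    · obtain ⟨r', rfl⟩ := hpr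
      exact ⟨r', p * s, by ring, hr.squarefree_of_dvd (dvd_mul_left _ _)⟩
    · exact ⟨p * r, s, by ring, squarefree_mul_iff.mpr
        ⟨hp.irreducible.isRelPrime_iff_not_dvd.mpr hpr, hp.irreducible.squarefree, hr⟩⟩

theorem Rat.exists_common_denominator (a b c : ℚ) :
    ∃ A B C D : ℤ, D ≠ 0 ∧ (A : ℚ) = a * D ∧ (B : ℚ) = b * D ∧ (C : ℚ) = c * D := by
  refine ⟨a.num * b.den * c.den, b.num * a.den * c.den, c.num * a.den * b.den,
    a.den * b.den * c.den, ?_, ?_, ?_, ?_⟩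
  · have h1 := a.den_ne_zero
    have h2 := b.den_ne_zero
    have h3 := c.den_ne_zero
    positivity
  · push_cast; rw [← Rat.mul_den_eq_num a]; ring
  · push_cast; rw [← Rat.mul_den_eq_num b]; ring
  · push_cast; rw [← Rat.mul_den_eq_num c]; ring

theorem Int.eq_zero_of_forall_even {P : ℤ → ℤ → ℤ → ℤ → Prop}
    (h : ∀ a b c w, P a b c w → ∃ a' b' c' w', w = 2 * w' ∧ P a' b' c' w')
    {a b c w : ℤ} (hw : P a b c w) : w = 0 := by
  suffices ∀ N : ℕ, ∀ a b c w, w.natAbs ≤ N → P a b c w → w = 0 from this _ a b c w le_rfl hw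
  intro N
  induction N with
  | zero => intro a b c w hN _; omega
  | succ N ih =>
    intro a b c w hN hw
    obtain ⟨a', b', c', w', rfl, h'⟩ := h a b c w hw
    by_contra h0
    have := ih a' b' c' w' (by omega) h'
    omega

theorem tribonacci_sq_coords_eq_zero {a b c w : ℤ} (h0 : a ^ 2 + 2 * b * c + c ^ 2 = 0)
    (h1 : 2 * a * b + 2 * b * c + 2 * c ^ 2 = w ^ 2)
    (h2 : b ^ 2 + 2 * a * c + 2 * b * c + 2 * c ^ 2 = 0) : w = 0 := by
  refine Int.eq_zero_of_forall_even (P := fun a b c w => a ^ 2 + 2 * b * c + c ^ 2 = 0 ∧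
    2 * a * b + 2 * b * c + 2 * c ^ 2 = w ^ 2 ∧ b ^ 2 + 2 * a * c + 2 * b * c + 2 * c ^ 2 = 0)
    ?_ ⟨h0, h1, h2⟩
  rintro a b c w ⟨h0, h1, h2⟩
  have hb : Even b := (Int.even_pow' two_ne_zero).mp (show Even (b ^ 2) from
    ⟨-(a * c + b * c + c ^ 2), by linear_combination h2⟩)
  have hw : Even w := (Int.even_pow' two_ne_zero).mp (show Even (w ^ 2) from
    ⟨a * b + b * c + c ^ 2, by linear_combination -h1⟩)
  obtain ⟨b, rfl⟩ := hb.two_dvd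
  obtain ⟨w, rfl⟩ := hw.two_dvd
  have hac : a ^ 2 + c ^ 2 = 4 * (-(b * c)) := by linear_combination h0
  have hc : Even c ∧ Even a := by
    rcases Int.even_or_odd a with ha | ha <;> rcases Int.even_or_odd c with hc | hc
    · exact ⟨hc, ha⟩
    · have := Int.sq_emod_four_of_even ha
      have := Int.sq_emod_four_of_odd hc
      omega
    · have := Int.sq_emod_four_of_odd ha
      have := Int.sq_emod_four_of_even hc
      omega
    · have := Int.sq_emod_four_of_odd ha
      have := Int.sq_emod_four_of_odd hc
      omega
  obtain ⟨c, rfl⟩ := hc.1.two_dvd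
  obtain ⟨a, rfl⟩ := hc.2.two_dvd
  exact ⟨a, b, c, w, rfl, by linarith, by linarith, by linarith⟩

theorem tribonacci_mul_sq_coords_eq_zero {a b c w : ℤ}
    (h1 : a ^ 2 + b ^ 2 + 3 * c ^ 2 + 2 * a * c + 4 * b * c = 2 * w ^ 2)
    (h2 : b ^ 2 + 4 * c ^ 2 + 2 * a * b + 2 * a * c + 4 * b * c = 0) : w = 0 := by
  refine Int.eq_zero_of_forall_even (P := fun a b c w =>
    a ^ 2 + b ^ 2 + 3 * c ^ 2 + 2 * a * c + 4 * b * c = 2 * w ^ 2 ∧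
    b ^ 2 + 4 * c ^ 2 + 2 * a * b + 2 * a * c + 4 * b * c = 0) ?_ ⟨h1, h2⟩
  rintro a b c w ⟨h1, h2⟩
  have hb : Even b := (Int.even_pow' two_ne_zero).mp (show Even (b ^ 2) from
    ⟨-(2 * c ^ 2 + a * b + a * c + 2 * b * c), by linear_combination h2⟩)
  obtain ⟨b, rfl⟩ := hb.two_dvd
  have hac : Even (a * c) := ⟨-(b ^ 2 + c ^ 2 + a * b + 2 * b * c), by linarith⟩
  have hac' : Even (a + c) := (Int.even_pow' two_ne_zero).mp (show Even ((a + c) ^ 2) from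
    ⟨w ^ 2 - 2 * b ^ 2 - c ^ 2 - 4 * b * c, by linear_combination h1⟩)
  have hc : Even c ∧ Even a := by
    rw [Int.even_mul] at hac
    rw [Int.even_add] at hac'
    tauto
  obtain ⟨c, rfl⟩ := hc.1.two_dvd
  obtain ⟨a, rfl⟩ := hc.2.two_dvd
  have hw : Even w := (Int.even_pow' two_ne_zero).mp (show Even (w ^ 2) from
    ⟨a ^ 2 + b ^ 2 + 3 * c ^ 2 + 2 * a * c + 4 * b * c, by linarith⟩)
  obtain ⟨w, rfl⟩ := hw.two_dvd
  exact ⟨a, b, c, w, rfl, by linarith, by linarith⟩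

/-- A common divisor of `-2q(p - tq)` and its complementary factor divides `3t² + t`. -/
theorem tribonacci_dvd_of_squarefree {R : Type*} [CommRing R] [IsDomain R]
    [UniqueFactorizationMonoid R] {t p q r : R} (ht : t ^ 3 = t ^ 2 + t + 1)
    (hco : IsCoprime p q) (hr : Squarefree r) (h1 : r ∣ -2 * q * (p - t * q))
    (h2 : r ∣ p ^ 2 + (t - 1) * p * q + (t ^ 2 - t - 1) * q ^ 2) : r ∣ 3 * t ^ 2 + t := by
  have hrq : IsCoprime r q := by
    refine IsCoprime.of_isCoprime_of_dvd_left ?_ h2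
    rw [show p ^ 2 + (t - 1) * p * q + (t ^ 2 - t - 1) * q ^ 2 =
      p ^ 2 + q * ((t - 1) * p + (t ^ 2 - t - 1) * q) by ring]
    exact IsCoprime.add_mul_left_left hco.pow_left _
  have h3 : r ∣ 2 * (p - t * q) := by
    refine hrq.dvd_of_dvd_mul_left (dvd_neg.mp ?_)
    convert h1 using 1
    ring
  have h4 : r ∣ q ^ 2 * (2 * (3 * t ^ 2 - 2 * t - 1)) := by
    have := (h2.mul_left 2).sub (h3.mul_right ((p - t * q) + 2 * t * q + (t - 1) * q))
    convert this using 1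
    ring
  have h5 : r ∣ 2 * (3 * t ^ 2 - 2 * t - 1) := hrq.pow_right.dvd_of_dvd_mul_left h4
  have e2 : (2 : R) = t ^ 2 * (t - 1) ^ 3 := by
    linear_combination (-(t ^ 2) + 2 * t - 2) * ht
  have e3 : 3 * t ^ 2 - 2 * t - 1 = (t - 1) ^ 2 * (2 * t ^ 2 + 1) := by
    linear_combination (-(2 * t) + 2) * ht
  have e4 : 3 * t ^ 2 + t = t * (t - 1) * (2 * t ^ 2 + 1) := by
    linear_combination (-(2 * t)) * ht
  refine (hr.dvd_pow_iff_dvd (n := 5) (by norm_num)).mp (h5.trans ?_)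
  refine ⟨t ^ 3 * (2 * t ^ 2 + 1) ^ 4, ?_⟩
  rw [e4, e3]
  linear_combination -((t - 1) ^ 2 * (2 * t ^ 2 + 1)) * (t ^ 3 * (2 * t ^ 2 + 1) ^ 4) * e2

section Tribonacci

open NumberField

variable {L : Type*} [Field L] [NumberField L] {θ : L}

theorem tribonacci_norm_self (hθ : θ ^ 3 = θ ^ 2 + θ + 1) (B : Module.Basis (Fin 3) ℚ L)
    (hB : ∀ i, B i = θ ^ (i : ℕ)) : Algebra.norm ℚ θ = 1 := by
  have h := tribonacci_norm hθ B hB 0 1 0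
  norm_num at h
  exact h

theorem tribonacci_norm_neg_sq (B : Module.Basis (Fin 3) ℚ L) (β : L) :
    Algebra.norm ℚ (-β ^ 2) = -(Algebra.norm ℚ β) ^ 2 := by
  rw [← neg_one_mul, map_mul, map_pow, show (-1 : L) = algebraMap ℚ L (-1) by simp,
    Algebra.norm_algebraMap, tribonacci_finrank B]
  ring

theorem tribonacci_not_sq (hθ : θ ^ 3 = θ ^ 2 + θ + 1) (B : Module.Basis (Fin 3) ℚ L)
    (hB : ∀ i, B i = θ ^ (i : ℕ)) (β : L) : θ ≠ β ^ 2 := by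
  intro h
  obtain ⟨a, b, c, rfl⟩ := tribonacci_exists_coords B hB β
  have h' : ((0 : ℚ) : L) + (1 : ℚ) * θ + (0 : ℚ) * θ ^ 2 =
      ((a ^ 2 + 2 * b * c + c ^ 2 : ℚ) : L) + (2 * a * b + 2 * b * c + 2 * c ^ 2 : ℚ) * θ +
        (b ^ 2 + 2 * a * c + 2 * b * c + 2 * c ^ 2 : ℚ) * θ ^ 2 := by
    push_cast
    linear_combination h + (2 * b * c + c ^ 2 + c ^ 2 * θ : L) * hθ
  obtain ⟨h0, h1, h2⟩ := tribonacci_coords_ext B hB h'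
  obtain ⟨A, B', C, D, hD, hA, hB', hC⟩ := Rat.exists_common_denominator a b c
  refine hD (tribonacci_sq_coords_eq_zero (a := A) (b := B') (c := C) ?_ ?_ ?_)
  · qify
    rw [hA, hB', hC]
    linear_combination -(D : ℚ) ^ 2 * h0
  · qify
    rw [hA, hB', hC]
    linear_combination -(D : ℚ) ^ 2 * h1
  · qify
    rw [hA, hB', hC]
    linear_combination -(D : ℚ) ^ 2 * h2

theorem tribonacci_exists_fundamental_unit (hθ : θ ^ 3 = θ ^ 2 + θ + 1)
    (B : Module.Basis (Fin 3) ℚ L) (hB : ∀ i, B i = θ ^ (i : ℕ)) :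
    ∃ ε : (𝓞 L)ˣ, ∀ u : (𝓞 L)ˣ, ∃ k : ℤ, u = ε ^ k ∨ u = -ε ^ k := by
  have hrank := tribonacci_unit_rank hθ B hB
  let i₀ : Fin (Units.rank L) := ⟨0, by omega⟩
  refine ⟨Units.fundSystem L i₀, fun u => ?_⟩
  obtain ⟨⟨ζ, e⟩, hu, -⟩ := Units.exist_unique_eq_mul_prod L u
  have hprod : ∏ i, Units.fundSystem L i ^ e i = Units.fundSystem L i₀ ^ e i₀ :=
    Fintype.prod_eq_single i₀ fun i hi => absurd (Fin.ext (by simp [i₀]; omega)) hi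
  have hodd : Odd (Module.finrank ℚ L) := by rw [tribonacci_finrank B]; decide
  refine ⟨e i₀, ?_⟩
  rw [hu, hprod]
  rcases Units.torsion_eq_one_or_neg_one_of_odd_finrank hodd ζ with h | h
  · left; simp [h]
  · right; simp [h]

theorem tribonacci_unit_eq_mul_sq (hθ : θ ^ 3 = θ ^ 2 + θ + 1) (B : Module.Basis (Fin 3) ℚ L)
    (hB : ∀ i, B i = θ ^ (i : ℕ)) (u : (𝓞 L)ˣ) :
    ∃ η : L, (u : L) = η ^ 2 ∨ (u : L) = -η ^ 2 ∨ (u : L) = θ * η ^ 2 ∨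
      (u : L) = -(θ * η ^ 2) := by
  obtain ⟨ε, hε⟩ := tribonacci_exists_fundamental_unit hθ B hB
  have hε0 : (ε : L) ≠ 0 := Units.coe_ne_zero ε
  have key (v : (𝓞 L)ˣ) : ∃ k : ℤ, (v : L) = (ε : L) ^ k ∨ (v : L) = -(ε : L) ^ k := by
    obtain ⟨k, rfl | rfl⟩ := hε v
    · exact ⟨k, .inl (Units.coe_zpow ε k)⟩
    · exact ⟨k, .inr (by rw [← Units.coe_zpow]; simp)⟩
  let t : 𝓞 L := ⟨θ, tribonacci_isIntegral hθ⟩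
  have ht : t * (t ^ 2 - t - 1) = 1 := by
    ext
    change θ * (θ ^ 2 - θ - 1) = 1
    linear_combination hθ
  obtain ⟨j, hj⟩ := key (Units.mkOfMulEqOne t _ ht)
  change θ = _ ∨ θ = _ at hj
  have hjodd : Odd j := by
    by_contra h
    obtain ⟨m, rfl⟩ := (Int.not_odd_iff_even.mp h).two_dvd
    rw [two_mul, zpow_add₀ hε0, ← sq] at hj
    rcases hj with hj | hj
    · exact tribonacci_not_sq hθ B hB _ hj
    · have h1 := tribonacci_norm_self hθ B hB
      have h2 := tribonacci_norm_neg_sq B ((ε : L) ^ m)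
      rw [← hj, h1] at h2
      nlinarith [sq_nonneg (Algebra.norm ℚ ((ε : L) ^ m))]
  obtain ⟨k, hk⟩ := key u
  rcases Int.even_or_odd k with hke | hko
  · obtain ⟨m, rfl⟩ := hke
    rw [zpow_add₀ hε0, ← sq] at hk
    exact ⟨(ε : L) ^ m, by tauto⟩
  · obtain ⟨m, hm⟩ : ∃ m, k = j + (m + m) := (hko.sub_odd hjodd).imp fun m hm => by omega
    rw [hm, zpow_add₀ hε0, zpow_add₀ hε0, ← sq] at hk
    refine ⟨(ε : L) ^ m, .inr (.inr ?_)⟩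
    rcases hj with hj | hj <;> rw [hj] <;> rcases hk with hk | hk <;> rw [hk] <;> simp

theorem Int.eq_one_of_sq_dvd_twenty_two {k : ℤ} (h : k ^ 2 ∣ 22) : k ^ 2 = 1 := by
  have h1 : k ^ 2 ≤ 22 := Int.le_of_dvd (by norm_num) h
  have h2 : k ≤ 4 := by nlinarith
  have h3 : -4 ≤ k := by nlinarith
  interval_cases k <;> revert h <;> decide

theorem tribonacci_isUnit_of_squarefree (hθ : θ ^ 3 = θ ^ 2 + θ + 1)
    (B : Module.Basis (Fin 3) ℚ L) (hB : ∀ i, B i = θ ^ (i : ℕ)) {p q W : ℤ} (hW0 : W ≠ 0)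
    (hco : IsCoprime p q)
    (hW : -2 * q * (p ^ 3 - p ^ 2 * q - p * q ^ 2 - q ^ 3) = W ^ 2) {t r s : 𝓞 L}
    (ht : (t : L) = θ) (hrs : -2 * (q : 𝓞 L) * (p - t * q) = r * s ^ 2) (hr : Squarefree r) :
    IsUnit r := by
  have := tribonacci_isPrincipalIdealRing hθ B hB
  have ht3 : t ^ 3 = t ^ 2 + t + 1 := by
    ext
    simpa [ht] using hθ
  have hWt : (r * s ^ 2) * (p ^ 2 + (t - 1) * p * q + (t ^ 2 - t - 1) * q ^ 2) =
      (W : 𝓞 L) ^ 2 := by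
    have hW' := congrArg (Int.cast : ℤ → 𝓞 L) hW
    push_cast at hW'
    rw [← hrs, ← hW']
    linear_combination (2 * (q : 𝓞 L) ^ 4) * ht3
  have hWt0 : (W : 𝓞 L) ≠ 0 := by exact_mod_cast hW0
  have hs0 : s ≠ 0 := by
    rintro rfl
    exact pow_ne_zero 2 hWt0 (by rw [← hWt]; ring)
  obtain ⟨W', hW'⟩ : s ∣ (W : 𝓞 L) :=
    (IsIntegrallyClosed.pow_dvd_pow_iff two_ne_zero).mp
      ⟨r * (p ^ 2 + (t - 1) * p * q + (t ^ 2 - t - 1) * q ^ 2), by rw [← hWt]; ring⟩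
  have hrg : r * (p ^ 2 + (t - 1) * p * q + (t ^ 2 - t - 1) * q ^ 2) = W' ^ 2 := by
    apply mul_left_cancel₀ (pow_ne_zero 2 hs0)
    rw [hW'] at hWt
    linear_combination hWt
  have hr0 : r ≠ 0 := hr.ne_zero
  obtain ⟨W'', rfl⟩ : r ∣ W' := (hr.dvd_pow_iff_dvd two_ne_zero).mp ⟨_, hrg.symm⟩
  have h2 : r ∣ p ^ 2 + (t - 1) * p * q + (t ^ 2 - t - 1) * q ^ 2 :=
    ⟨W'' ^ 2, mul_left_cancel₀ hr0 (by linear_combination hrg)⟩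
  have hdvd := tribonacci_dvd_of_squarefree ht3
    (show IsCoprime (p : 𝓞 L) (q : 𝓞 L) from hco.map (Int.castRingHom (𝓞 L))) hr ⟨s ^ 2, hrs⟩ h2
  have hN22 : Algebra.norm ℤ (3 * t ^ 2 + t) = 22 := by
    have h := tribonacci_norm hθ B hB 0 1 3
    qify
    rw [Algebra.coe_norm_int]
    norm_num at h
    simp only [map_add, map_mul, map_pow, map_ofNat, ht]
    rw [add_comm, h]
  have hNr : Algebra.norm ℤ r ∣ 22 := hN22 ▸ map_dvd (Algebra.norm ℤ) hdvd
  have hNy : Algebra.norm ℤ r * (Algebra.norm ℤ s) ^ 2 = (2 * q * W) ^ 2 := by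
    have h := tribonacci_norm hθ B hB (-2 * q * p) (2 * q ^ 2) 0
    rw [← map_pow, ← map_mul, ← hrs]
    qify
    rw [Algebra.coe_norm_int]
    have hW' := congrArg (Int.cast : ℤ → ℚ) hW
    push_cast at hW'
    have e : ((-2 * (q : 𝓞 L) * (p - t * q) : 𝓞 L) : L) =
      ((-2 * q * p : ℚ) : L) + (2 * q ^ 2 : ℚ) * θ + (0 : ℚ) * θ ^ 2 := by
      push_cast
      simp only [map_ofNat, map_intCast, ht]
      ring
    rw [e, h]
    linear_combination 4 * (q : ℚ) ^ 2 * hW'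
  have hNs0 : Algebra.norm ℤ s ≠ 0 := Algebra.norm_ne_zero_iff.mpr hs0
  obtain ⟨k, hk⟩ : Algebra.norm ℤ s ∣ 2 * q * W :=
    (Int.pow_dvd_pow_iff two_ne_zero).mp ⟨Algebra.norm ℤ r, by rw [← hNy]; ring⟩
  have hNk : Algebra.norm ℤ r = k ^ 2 := by
    apply mul_right_cancel₀ (pow_ne_zero 2 hNs0)
    rw [hNy, hk]
    ring
  rw [NumberField.isUnit_iff_norm, RingOfIntegers.coe_norm, ← Algebra.coe_norm_int, hNk,
    Int.eq_one_of_sq_dvd_twenty_two (hNk ▸ hNr)]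
  simp

theorem tribonacci_eq_sq_or_eq_mul_sq (hθ : θ ^ 3 = θ ^ 2 + θ + 1)
    (B : Module.Basis (Fin 3) ℚ L) (hB : ∀ i, B i = θ ^ (i : ℕ)) {p q W : ℤ} (hq : q ≠ 0)
    (hW0 : W ≠ 0) (hco : IsCoprime p q)
    (hW : -2 * q * (p ^ 3 - p ^ 2 * q - p * q ^ 2 - q ^ 3) = W ^ 2) :
    ∃ β : L, -2 * (q : L) * (p - θ * q) = β ^ 2 ∨ -2 * (q : L) * (p - θ * q) = θ * β ^ 2 := by
  have := tribonacci_isPrincipalIdealRing hθ B hB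
  have hnorm : Algebra.norm ℚ (-2 * (q : L) * (p - θ * q)) = (2 * q * W) ^ 2 := by
    have h := tribonacci_norm hθ B hB (-2 * q * p) (2 * q ^ 2) 0
    have hW' := congrArg (Int.cast : ℤ → ℚ) hW
    push_cast at hW'
    rw [show -2 * (q : L) * (p - θ * q) =
      ((-2 * q * p : ℚ) : L) + (2 * q ^ 2 : ℚ) * θ + (0 : ℚ) * θ ^ 2 by push_cast; ring, h]
    linear_combination 4 * (q : ℚ) ^ 2 * hW'
  have hpos : 0 < Algebra.norm ℚ (-2 * (q : L) * (p - θ * q)) := by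
    rw [hnorm]
    have : (2 * q * W : ℚ) ≠ 0 := by exact_mod_cast mul_ne_zero (mul_ne_zero two_ne_zero hq) hW0
    positivity
  let t : 𝓞 L := ⟨θ, tribonacci_isIntegral hθ⟩
  have ht : (t : L) = θ := rfl
  have hyL : ((-2 * (q : 𝓞 L) * (p - t * q) : 𝓞 L) : L) = -2 * (q : L) * (p - θ * q) := by
    simp only [map_sub, map_mul, map_neg, map_ofNat, map_intCast, ht]
  have hy0 : -2 * (q : 𝓞 L) * (p - t * q) ≠ 0 := by
    intro h
    rw [h] at hyL
    rw [← hyL] at hpos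
    simp at hpos
  obtain ⟨r, s, hrs, hr⟩ := exists_eq_squarefree_mul_sq hy0
  obtain ⟨u, rfl⟩ := tribonacci_isUnit_of_squarefree hθ B hB hW0 hco hW ht hrs hr
  have hyu : -2 * (q : L) * (p - θ * q) = (u : L) * (s : L) ^ 2 := by
    rw [← hyL, hrs]
    simp
  obtain ⟨η, hu | hu | hu | hu⟩ := tribonacci_unit_eq_mul_sq hθ B hB u
  · exact ⟨η * s, .inl (by rw [hyu, hu]; ring)⟩
  · exfalso
    rw [show -2 * (q : L) * (p - θ * q) = -(η * s) ^ 2 by rw [hyu, hu]; ring,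
      tribonacci_norm_neg_sq B] at hpos
    nlinarith [sq_nonneg (Algebra.norm ℚ (η * (s : L)))]
  · exact ⟨η * s, .inr (by rw [hyu, hu]; ring)⟩
  · exfalso
    rw [show -2 * (q : L) * (p - θ * q) = θ * (-(η * s) ^ 2) by rw [hyu, hu]; ring, map_mul,
      tribonacci_norm_self hθ B hB, tribonacci_norm_neg_sq B] at hpos
    nlinarith [sq_nonneg (Algebra.norm ℚ (η * (s : L)))]

end Tribonacci

theorem tribonacci_rat_ne_zero (r : ℚ) : r ^ 3 - r ^ 2 - r - 1 ≠ 0 := by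
  intro h
  obtain ⟨n, rfl⟩ := IsIntegrallyClosed.isIntegral_iff.mp
    (tribonacci_isIntegral (θ := r) (by linear_combination h))
  rw [eq_intCast] at h
  have h' : n * (n ^ 2 - n - 1) = 1 := by
    qify
    linear_combination h
  rcases Int.eq_one_or_neg_one_of_mul_eq_one h' with rfl | rfl <;> norm_num at h'

theorem tribonacci_exists_sqrt_coords {L : Type*} [Field L] [NumberField L] {θ : L}
    (hθ : θ ^ 3 = θ ^ 2 + θ + 1) (B : Module.Basis (Fin 3) ℚ L) (hB : ∀ i, B i = θ ^ (i : ℕ))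
    {x z : ℚ} (h : z ^ 2 = -2 * (x ^ 3 - x ^ 2 - x - 1)) :
    ∃ a b c : ℚ, a ^ 2 + 2 * b * c + c ^ 2 = -2 * x ∧ 2 * a * b + 2 * b * c + 2 * c ^ 2 = 2 ∧
      b ^ 2 + 2 * a * c + 2 * b * c + 2 * c ^ 2 = 0 := by
  have hq : (x.den : ℤ) ≠ 0 := by exact_mod_cast x.den_ne_zero
  have hxq : x * x.den = x.num := Rat.mul_den_eq_num x
  have hqQ : (x.den : ℚ) ≠ 0 := by exact_mod_cast x.den_ne_zero
  have hxL : (x : L) * x.den = x.num := by exact_mod_cast congrArg (Rat.cast : ℚ → L) hxq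
  have hqL : (x.den : L) ≠ 0 := by exact_mod_cast x.den_ne_zero
  obtain ⟨W, hW, hWz⟩ := Rat.exists_int_sq (r := z * x.den ^ 2)
    (a := -2 * x.den * (x.num ^ 3 - x.num ^ 2 * x.den - x.num * x.den ^ 2 - x.den ^ 3)) (by
      push_cast
      rw [← hxq]
      linear_combination -(x.den : ℚ) ^ 4 * h)
  have hW0 : W ≠ 0 := by
    rintro rfl
    have hz : z = 0 := by
      rcases mul_eq_zero.mp (hWz.symm.trans Int.cast_zero) with hz | hz
      · exact hz
      · exact absurd hz (pow_ne_zero 2 hqQ)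
    exact tribonacci_rat_ne_zero x (by rw [hz] at h; linarith)
  obtain ⟨β, hβ⟩ :=
    tribonacci_eq_sq_or_eq_mul_sq hθ B hB hq hW0 (Rat.isCoprime_num_den x) hW
  obtain ⟨a, b, c, habc⟩ := tribonacci_exists_coords B hB (β / x.den)
  have hβ' : β = ((a : L) + b * θ + c * θ ^ 2) * x.den := by
    rw [← habc]
    field_simp
  rw [hβ', ← hxL] at hβ
  push_cast at hβ
  rcases hβ with hβ | hβ
  · have h' : ((a ^ 2 + 2 * b * c + c ^ 2 : ℚ) : L) + (2 * a * b + 2 * b * c + 2 * c ^ 2 : ℚ) * θ +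
        (b ^ 2 + 2 * a * c + 2 * b * c + 2 * c ^ 2 : ℚ) * θ ^ 2 =
        ((-2 * x : ℚ) : L) + (2 : ℚ) * θ + (0 : ℚ) * θ ^ 2 := by
      apply mul_right_cancel₀ (pow_ne_zero 2 hqL)
      push_cast
      linear_combination -hβ - (x.den : L) ^ 2 * (2 * b * c + c ^ 2 + c ^ 2 * θ : L) * hθ
    exact ⟨a, b, c, tribonacci_coords_ext B hB h'⟩
  · exfalso
    have h' : ((b ^ 2 + 2 * a * c + 2 * b * c + 2 * c ^ 2 : ℚ) : L) +
        (a ^ 2 + b ^ 2 + 3 * c ^ 2 + 2 * a * c + 4 * b * c : ℚ) * θ +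
        (b ^ 2 + 4 * c ^ 2 + 2 * a * b + 2 * a * c + 4 * b * c : ℚ) * θ ^ 2 =
        ((-2 * x : ℚ) : L) + (2 : ℚ) * θ + (0 : ℚ) * θ ^ 2 := by
      apply mul_right_cancel₀ (pow_ne_zero 2 hqL)
      push_cast
      linear_combination -hβ - (x.den : L) ^ 2 *
        (b ^ 2 + 2 * a * c + 2 * b * c + 2 * c ^ 2 + (2 * b * c + c ^ 2) * θ + c ^ 2 * θ ^ 2 : L) *
        hθ
    obtain ⟨-, h1, h2⟩ := tribonacci_coords_ext B hB h'
    obtain ⟨A, B', C, D, hD, hA, hB', hC⟩ := Rat.exists_common_denominator a b c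
    refine hD (tribonacci_mul_sq_coords_eq_zero (a := A) (b := B') (c := C) ?_ ?_)
    · qify
      rw [hA, hB', hC]
      linear_combination (D : ℚ) ^ 2 * h1
    · qify
      rw [hA, hB', hC]
      linear_combination (D : ℚ) ^ 2 * h2

open Polynomial in
theorem tribonacci_irreducible : Irreducible (X ^ 3 - X ^ 2 - X - 1 : ℚ[X]) := by
  have hdeg : (X ^ 3 - X ^ 2 - X - 1 : ℚ[X]).natDegree = 3 := by compute_degree!
  rw [irreducible_iff_roots_eq_zero_of_degree_le_three (by rw [hdeg]; norm_num) hdeg.le]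
  refine Multiset.eq_zero_of_forall_notMem fun r hr => tribonacci_rat_ne_zero r ?_
  have := isRoot_of_mem_roots hr
  simpa [IsRoot] using this

open Polynomial in
/-- Every rational point of `z² = -2(x³ - x² - x - 1)` is twice a rational point, so that its
`x`-coordinate is given by the duplication formula. -/
theorem exists_rat_halving {x z : ℚ} (h : z ^ 2 = -2 * (x ^ 3 - x ^ 2 - x - 1)) :
    ∃ m w : ℚ, w ^ 2 = -2 * (m ^ 3 - m ^ 2 - m - 1) ∧
      4 * (m ^ 3 - m ^ 2 - m - 1) * x = m ^ 4 + 2 * m ^ 2 + 8 * m - 3 := by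
  obtain ⟨a, b, c, h0, h1, h2⟩ : ∃ a b c : ℚ, a ^ 2 + 2 * b * c + c ^ 2 = -2 * x ∧
      2 * a * b + 2 * b * c + 2 * c ^ 2 = 2 ∧ b ^ 2 + 2 * a * c + 2 * b * c + 2 * c ^ 2 = 0 := by
    let f : ℚ[X] := X ^ 3 - X ^ 2 - X - 1
    have : Fact (Irreducible f) := ⟨tribonacci_irreducible⟩
    have hf0 : f ≠ 0 := tribonacci_irreducible.ne_zero
    have hdeg : f.natDegree = 3 := by unfold f; compute_degree!
    let pb := AdjoinRoot.powerBasis hf0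
    have : FiniteDimensional ℚ (AdjoinRoot f) := pb.finite
    have : NumberField (AdjoinRoot f) := { }
    have hroot : (AdjoinRoot.root f) ^ 3 = (AdjoinRoot.root f) ^ 2 + AdjoinRoot.root f + 1 := by
      have := AdjoinRoot.eval₂_root f
      simp only [f, eval₂_sub, eval₂_pow, eval₂_X, eval₂_one] at this
      linear_combination this
    refine tribonacci_exists_sqrt_coords hroot
      (pb.basis.reindex (finCongr (by simp [pb, hdeg]))) (fun i => ?_) h
    simp [pb]
  have hc : c ≠ 0 := by
    rintro rfl
    have : b = 0 := by simpa using h2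
    rw [this] at h1
    norm_num at h1
  obtain ⟨m, hm⟩ : ∃ m, b = c * (m - 1) := ⟨b / c + 1, by field_simp; ring⟩
  obtain ⟨α, hα⟩ : ∃ α, a = c * α := ⟨a / c, by field_simp⟩
  subst hm hα
  have hα : α = -(m ^ 2 + 1) / 2 := by
    apply mul_left_cancel₀ (pow_ne_zero 2 hc)
    linear_combination h2 / 2
  subst hα
  have hf : c ^ 2 * (m ^ 3 - m ^ 2 - m - 1) = -2 := by linear_combination -h1
  refine ⟨m, 2 / c, ?_, ?_⟩
  · field_simp
    linear_combination hf
  · apply mul_left_cancel₀ (pow_ne_zero 2 hc)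
    linear_combination 4 * x * hf - 4 * h0

theorem Int.eq_or_eq_neg_of_cubic_sq {M N W : ℤ} (hM : |M| ≤ 9) (hN : 0 < N) (hN' : N ≤ 9)
    (hco : IsCoprime M N)
    (h : -2 * N * (M ^ 3 - M ^ 2 * N - M * N ^ 2 - N ^ 3) = W ^ 2) : M = N ∨ M = -N := by
  obtain ⟨h1, h2⟩ := abs_le.mp hM
  have hsq : IsSquare (-2 * N * (M ^ 3 - M ^ 2 * N - M * N ^ 2 - N ^ 3)) := ⟨W, by rw [h, sq]⟩
  clear h hM
  rw [Int.isCoprime_iff_gcd_eq_one] at hco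
  interval_cases N <;> interval_cases M <;> first
    | exact .inl rfl
    | exact .inr rfl
    | exact absurd hco (by decide)
    | exact absurd hsq (by norm_num)

/-- Height inequality for the duplication formula on `z² = -2(x³ - x² - x - 1)`. -/
theorem duplication_height_bound {P Q M N : ℤ} (hPQ : IsCoprime P Q) (hMN : IsCoprime M N)
    (hN : N ≠ 0) (hF : M ^ 3 - M ^ 2 * N - M * N ^ 2 - N ^ 3 ≠ 0)
    (h : 4 * N * (M ^ 3 - M ^ 2 * N - M * N ^ 2 - N ^ 3) * P =
      (M ^ 4 + 2 * M ^ 2 * N ^ 2 + 8 * M * N ^ 3 - 3 * N ^ 4) * Q) :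
    max |M| |N| ^ 4 ≤ 958 * max |P| |Q| := by
  obtain ⟨d, hd⟩ : Q ∣ 4 * N * (M ^ 3 - M ^ 2 * N - M * N ^ 2 - N ^ 3) :=
    hPQ.symm.dvd_of_dvd_mul_right (Dvd.intro_left _ h.symm)
  have hH0 : 4 * N * (M ^ 3 - M ^ 2 * N - M * N ^ 2 - N ^ 3) ≠ 0 :=
    mul_ne_zero (mul_ne_zero (by norm_num) hN) hF
  have hQ0 : Q ≠ 0 := by
    rintro rfl
    exact hH0 (by rw [hd, zero_mul])
  have hG : M ^ 4 + 2 * M ^ 2 * N ^ 2 + 8 * M * N ^ 3 - 3 * N ^ 4 = P * d := by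
    apply mul_right_cancel₀ hQ0
    rw [← h, hd]
    ring
  have hM7 : 176 * M ^ 7 = d *
      ((-132 * N ^ 3 - 112 * M * N ^ 2 - 100 * M ^ 2 * N + 176 * M ^ 3) * P +
      (99 * N ^ 3 - 279 * M * N ^ 2 - 35 * M ^ 2 * N + 25 * M ^ 3) * Q) := by
    linear_combination
      (-132 * N ^ 3 - 112 * M * N ^ 2 - 100 * M ^ 2 * N + 176 * M ^ 3) * hG +
      (99 * N ^ 3 - 279 * M * N ^ 2 - 35 * M ^ 2 * N + 25 * M ^ 3) * hd
  have hN7 : 176 * N ^ 7 = d *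
      ((-20 * N ^ 3 - 8 * M * N ^ 2 + 12 * M ^ 2 * N) * P +
      (-29 * N ^ 3 - 5 * M * N ^ 2 - M ^ 2 * N - 3 * M ^ 3) * Q) := by
    linear_combination
      (-20 * N ^ 3 - 8 * M * N ^ 2 + 12 * M ^ 2 * N) * hG +
      (-29 * N ^ 3 - 5 * M * N ^ 2 - M ^ 2 * N - 3 * M ^ 3) * hd
  have hd176 : d ∣ 176 := by
    obtain ⟨u, v, huv⟩ := hMN.pow (m := 7) (n := 7)
    have : (176 : ℤ) = u * (176 * M ^ 7) + v * (176 * N ^ 7) := by linear_combination -176 * huv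
    rw [this, hM7, hN7]
    exact dvd_add ((dvd_mul_right _ _).mul_left _) ((dvd_mul_right _ _).mul_left _)
  have hd' : |d| ≤ 176 := Int.le_of_dvd (by norm_num) ((abs_dvd _ _).mpr hd176)
  set k := max |P| |Q|
  set n := max |M| |N| with hn
  have hPk : |P| ≤ k := le_max_left _ _
  have hQk : |Q| ≤ k := le_max_right _ _
  have hMn : |M| ≤ n := le_max_left _ _
  have hNn : |N| ≤ n := le_max_right _ _
  have hn0 : 0 < n := (abs_pos.mpr hN).trans_le hNn
  have hk0 : 0 ≤ k := (abs_nonneg P).trans hPk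
  have mono (i j : ℕ) (hij : i + j = 3) : |M| ^ i * |N| ^ j ≤ n ^ 3 := by
    rw [← hij, pow_add]
    gcongr
  have h30 := mono 3 0 rfl
  have h21 := mono 2 1 rfl
  have h12 := mono 1 2 rfl
  have h03 := mono 0 3 rfl
  simp only [pow_zero, pow_one, mul_one, one_mul] at h30 h21 h12 h03
  have cubic (a b c e : ℤ) : |a * N ^ 3 + b * M * N ^ 2 + c * M ^ 2 * N + e * M ^ 3| ≤
      (|a| + |b| + |c| + |e|) * n ^ 3 := by
    calc _ ≤ |a * N ^ 3| + |b * M * N ^ 2| + |c * M ^ 2 * N| + |e * M ^ 3| :=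
          (abs_add_le _ _).trans (add_le_add_left (abs_add_three _ _ _) _)
      _ = |a| * |N| ^ 3 + |b| * (|M| * |N| ^ 2) + |c| * (|M| ^ 2 * |N|) + |e| * |M| ^ 3 := by
          simp only [abs_mul, abs_pow, mul_assoc]
      _ ≤ |a| * n ^ 3 + |b| * n ^ 3 + |c| * n ^ 3 + |e| * n ^ 3 := by gcongr
      _ = _ := by ring
  have combine (s t : ℤ) (a b : ℤ) (hs : |s| ≤ a * n ^ 3) (ht : |t| ≤ b * n ^ 3)
      (hab : a + b ≤ 958) : |d * (s * P + t * Q)| ≤ 176 * (958 * n ^ 3 * k) := by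
    rw [abs_mul]
    have h1 : |s * P + t * Q| ≤ 958 * n ^ 3 * k :=
      calc |s * P + t * Q| ≤ |s| * |P| + |t| * |Q| := by
            rw [← abs_mul, ← abs_mul]; exact abs_add_le _ _
        _ ≤ (a * n ^ 3) * k + (b * n ^ 3) * k :=
            add_le_add (mul_le_mul hs hPk (abs_nonneg _) ((abs_nonneg s).trans hs))
              (mul_le_mul ht hQk (abs_nonneg _) ((abs_nonneg t).trans ht))
        _ = (a + b) * (n ^ 3 * k) := by ring
        _ ≤ 958 * (n ^ 3 * k) := by gcongr
        _ = _ := by ring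
    gcongr
  have hM7' : 176 * |M| ^ 7 ≤ 176 * (958 * n ^ 3 * k) := by
    have := combine _ _ _ _ (cubic (-132) (-112) (-100) 176) (cubic 99 (-279) (-35) 25)
      (by norm_num)
    rw [show 176 * |M| ^ 7 = |176 * M ^ 7| by simp [abs_mul], hM7]
    refine le_trans (le_of_eq (congrArg _ ?_)) this
    ring
  have hN7' : 176 * |N| ^ 7 ≤ 176 * (958 * n ^ 3 * k) := by
    have := combine _ _ _ _ (cubic (-20) (-8) 12 0) (cubic (-29) (-5) (-1) (-3))
      (by norm_num)
    rw [show 176 * |N| ^ 7 = |176 * N ^ 7| by simp [abs_mul], hN7]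
    refine le_trans (le_of_eq (congrArg _ ?_)) this
    ring
  have hn7 : n ^ 7 ≤ 958 * n ^ 3 * k := by
    rcases max_choice |M| |N| with h' | h' <;> rw [← hn] at h'
    · rw [← h'] at hM7'
      linarith
    · rw [← h'] at hN7'
      linarith
  refine le_of_mul_le_mul_left ?_ (pow_pos hn0 3)
  linarith [hn7, pow_add n 3 4]

theorem eq_one_or_neg_one_of_rat_cubic {x z : ℚ} (h : z ^ 2 = -2 * (x ^ 3 - x ^ 2 - x - 1)) :
    x = 1 ∨ x = -1 := by
  suffices ∀ k : ℕ, ∀ x z : ℚ, max x.num.natAbs x.den ≤ k →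
      z ^ 2 = -2 * (x ^ 3 - x ^ 2 - x - 1) → x = 1 ∨ x = -1 from this _ x z le_rfl h
  intro k
  induction k with
  | zero =>
    intro x z hx
    have := x.den_pos
    omega
  | succ k ih =>
    intro x z hx hxz
    obtain ⟨m, w, hmw, hmx⟩ := exists_rat_halving hxz
    suffices hm : m = 1 ∨ m = -1 by
      rcases hm with rfl | rfl
      · right; linarith
      · left; linarith
    by_cases hk : max m.num.natAbs m.den ≤ k
    · exact ih m w hk hmw
    have hmq : m * m.den = m.num := Rat.mul_den_eq_num m
    have hxq : x * x.den = x.num := Rat.mul_den_eq_num x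
    have hmd : (m.den : ℚ) ≠ 0 := by exact_mod_cast m.den_ne_zero
    have hF : m.num ^ 3 - m.num ^ 2 * m.den - m.num * m.den ^ 2 - m.den ^ 3 ≠ 0 := by
      intro h0
      refine tribonacci_rat_ne_zero m (mul_left_cancel₀ (pow_ne_zero 3 hmd) ?_)
      qify at h0
      rw [← hmq] at h0
      linear_combination h0
    have hbound := duplication_height_bound (Rat.isCoprime_num_den x) (Rat.isCoprime_num_den m)
      (by exact_mod_cast m.den_ne_zero) hF (by
        qify
        rw [← hmq, ← hxq]
        linear_combination (m.den : ℚ) ^ 4 * x.den * hmx)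
    have hle : max |x.num| |(x.den : ℤ)| ≤ max |m.num| |(m.den : ℤ)| := by
      simp only [Int.abs_eq_natAbs]
      omega
    have hn : max |m.num| |(m.den : ℤ)| ≤ 9 := by
      by_contra! hlt
      set n := max |m.num| |(m.den : ℤ)|
      have h3 : 10 ^ 3 ≤ n ^ 3 := pow_le_pow_left₀ (by norm_num) (by omega) 3
      nlinarith
    obtain ⟨W, hW, -⟩ := Rat.exists_int_sq (r := w * m.den ^ 2)
      (a := -2 * m.den * (m.num ^ 3 - m.num ^ 2 * m.den - m.num * m.den ^ 2 - m.den ^ 3)) (by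
        push_cast
        rw [← hmq]
        linear_combination -(m.den : ℚ) ^ 4 * hmw)
    rcases Int.eq_or_eq_neg_of_cubic_sq (le_of_max_le_left hn)
      (by exact_mod_cast m.den_pos) ((le_abs_self _).trans (le_of_max_le_right hn))
      (Rat.isCoprime_num_den m) hW with h' | h'
    · left
      apply mul_right_cancel₀ hmd
      rw [hmq, h']
      simp
    · right
      apply mul_right_cancel₀ hmd
      rw [hmq, h']
      simp

/-- If `X² + AX + B` divides `2(X³ - X² - X - 1) + (α + βX)²`, then the remaining root gives a
rational point of the cubic, which determines `A` and `B` up to one parameter. -/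
theorem quadratic_coeffs_of_cubic {A B α β : ℚ}
    (h1 : 2 * α * β - β ^ 2 * A = -2 * (A ^ 2 - B + A - 1))
    (h0 : α ^ 2 - β ^ 2 * B = -2 * (A * B + B - 1)) :
    (∃ b, A = b ^ 2 / 2 ∧ B = 2 * b - b ^ 2 / 2 - 1) ∨
      ∃ b, A = b ^ 2 / 2 - 2 ∧ B = 1 + 2 * b + b ^ 2 / 2 := by
  obtain ⟨x₀, hx₀⟩ : ∃ x₀, x₀ = A + 1 - β ^ 2 / 2 := ⟨_, rfl⟩
  have hA : A = x₀ - 1 + β ^ 2 / 2 := by linear_combination -hx₀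
  subst hA
  have hpt : (α + β * x₀) ^ 2 = -2 * (x₀ ^ 3 - x₀ ^ 2 - x₀ - 1) := by
    linear_combination x₀ * h1 + h0
  rcases eq_one_or_neg_one_of_rat_cubic hpt with rfl | rfl
  · left
    rcases sq_eq_sq_iff_eq_or_eq_neg.mp (show (α + β * 1) ^ 2 = 2 ^ 2 by linarith) with h | h
    · obtain rfl : α = 2 - β := by linarith
      exact ⟨β, by ring, by linear_combination h0 / 2⟩
    · obtain rfl : α = -2 - β := by linarith
      exact ⟨-β, by ring, by linear_combination h0 / 2⟩
  · right
    rcases sq_eq_sq_iff_eq_or_eq_neg.mp (show (α + β * -1) ^ 2 = 2 ^ 2 by linarith) with h | h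
    · obtain rfl : α = 2 + β := by linarith
      exact ⟨β, by ring, by linear_combination -h0 / 2⟩
    · obtain rfl : α = -2 + β := by linarith
      exact ⟨-β, by ring, by linear_combination -h0 / 2⟩

/-- If `X² + AX + B` divides `(X² - 3)(X² + 1) + (γ + δX)²`, then moving `γ + δX` within its class
modulo the quadratic so as to pass through `(1, 2)` leaves one more rational point of the quartic,
which determines `A` and `B` up to one parameter. -/
theorem quadratic_coeffs_of_quartic {A B γ δ : ℚ} (hm : 1 + A + B ≠ 0)
    (h1 : 2 * γ * δ - δ ^ 2 * A = A ^ 3 - 2 * A * B - 2 * A)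
    (h0 : γ ^ 2 - δ ^ 2 * B = A ^ 2 * B - B ^ 2 - 2 * B + 3) :
    (∃ k, A = 0 ∧ (1 + k ^ 2) * (B + 1) = 4 * k) ∨ A ^ 2 + (B - 1) ^ 2 = 4 := by
  obtain ⟨k, hk⟩ : ∃ k, γ + δ + k * (1 + A + B) = 2 :=
    ⟨(2 - γ - δ) / (1 + A + B), by field_simp; ring⟩
  have hk0 : 1 + k ^ 2 ≠ 0 := by positivity
  have hS1 : 1 - A + (δ ^ 2 - 2 - B + A ^ 2) + 2 * k * (γ + δ) + k ^ 2 * (1 + A + B) = 0 := by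
    apply mul_left_cancel₀ hm
    linear_combination (γ + δ + k * (1 + A + B) + 2) * hk - h1 - h0
  obtain ⟨x₀, hx₀⟩ : ∃ x₀, -A + 2 * k * δ + k ^ 2 * A = -(1 + k ^ 2) * (1 + x₀) :=
    ⟨(A - 2 * k * δ - k ^ 2 * A) / (1 + k ^ 2) - 1, by field_simp; ring⟩
  have hS0 : δ ^ 2 - 2 - B + A ^ 2 + 2 * k * γ + k ^ 2 * B = (1 + k ^ 2) * x₀ := by
    linear_combination hS1 - hx₀
  have hpt : (γ + δ * x₀ + k * (x₀ ^ 2 + A * x₀ + B)) ^ 2 = -(x₀ ^ 2 - 3) * (x₀ ^ 2 + 1) := by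
    linear_combination x₀ * h1 + h0 + (x₀ ^ 2 + A * x₀ + B) * (x₀ * hx₀ + hS0)
  rcases eq_one_or_neg_one_of_rat_quartic hpt with rfl | rfl
  · right
    have hδ : δ = -2 * k - k * A := by
      linear_combination h1 / 4 - (δ + k * (2 + A)) / 2 * hk + (2 + A) / 4 * hS1 +
        (1 + A + B) / 4 * hx₀
    have hγ : γ = 2 + k - k * B := by linear_combination hk - hδ
    subst hδ hγ
    have hA : (1 + k ^ 2) * A = 2 - 2 * k ^ 2 := by linear_combination -hx₀
    have hB : (1 + k ^ 2) * (B - 1) = 4 * k := by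
      linear_combination -hS0 + (A + 2) * hA
    apply mul_left_cancel₀ (pow_ne_zero 2 hk0)
    linear_combination ((1 + k ^ 2) * A + (2 - 2 * k ^ 2)) * hA +
      ((1 + k ^ 2) * (B - 1) + 4 * k) * hB
  · rcases sq_eq_sq_iff_eq_or_eq_neg.mp (show (γ + δ * -1 + k * ((-1) ^ 2 + A * -1 + B)) ^ 2 = 2 ^ 2
      by linarith) with h | h
    · left
      have hδ : δ = -k * A := by linear_combination (hk - h) / 2
      have hA : A = 0 := by
        apply mul_left_cancel₀ hk0
        rw [hδ] at hx₀
        linear_combination -hx₀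
      subst hA
      obtain rfl : δ = 0 := by linarith
      obtain rfl : γ = 2 - k - k * B := by linear_combination hk
      exact ⟨k, rfl, by linear_combination -hS0⟩
    · right
      have hδ : δ = 2 - k * A := by linear_combination (hk - h) / 2
      have hγ : γ = -k - k * B := by linear_combination hk - hδ
      subst hδ hγ
      have hA : (1 + k ^ 2) * A = 4 * k := by linear_combination -hx₀
      have hB : (1 + k ^ 2) * (B - 1) = 2 - 2 * k ^ 2 := by
        linear_combination -hS0 + A * hA
      apply mul_left_cancel₀ (pow_ne_zero 2 hk0)
      linear_combination ((1 + k ^ 2) * A + 4 * k) * hA +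
        ((1 + k ^ 2) * (B - 1) + 2 - 2 * k ^ 2) * hB

theorem exists_root_of_quadratic_coeffs {A B : ℚ}
    (h : (∃ b, A = b ^ 2 / 2 ∧ B = 2 * b - b ^ 2 / 2 - 1) ∨
      ∃ b, A = b ^ 2 / 2 - 2 ∧ B = 1 + 2 * b + b ^ 2 / 2)
    (h' : (∃ k, A = 0 ∧ (1 + k ^ 2) * (B + 1) = 4 * k) ∨ A ^ 2 + (B - 1) ^ 2 = 4) :
    ∃ r : ℚ, r ^ 2 + A * r + B = 0 := by
  rcases h with ⟨b, rfl, rfl⟩ | ⟨b, rfl, rfl⟩ <;> rcases h' with ⟨k, hA, hB⟩ | h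
  · obtain rfl : b = 0 := by simpa using hA
    exact ⟨1, by norm_num⟩
  · have hb : b * (b - 2) * (b ^ 2 - 2 * b + 8) = 0 := by linear_combination 2 * h
    rcases mul_eq_zero.mp hb with hb | hb
    · rcases mul_eq_zero.mp hb with rfl | hb
      · exact ⟨1, by norm_num⟩
      · obtain rfl : b = 2 := by linarith
        exact ⟨-1, by norm_num⟩
    · nlinarith [sq_nonneg (b - 1)]
  · rcases sq_eq_sq_iff_eq_or_eq_neg.mp (show b ^ 2 = 2 ^ 2 by linarith) with rfl | rfl
    · nlinarith [sq_nonneg (4 * k - 1)]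
    · exact ⟨1, by norm_num⟩
  · have hb : b * (b + 2) = 0 := by
      rw [← sq_eq_zero_iff]
      linear_combination 2 * h
    rcases mul_eq_zero.mp hb with rfl | hb
    · exact ⟨1, by norm_num⟩
    · obtain rfl : b = -2 := by linarith
      exact ⟨1, by norm_num⟩

section QuadraticField

variable {K : Type*} [Field K] [NumberField K]

theorem rat_add_mul_eq_zero {x : K} (hx : ∀ r : ℚ, x ≠ r) {a b : ℚ} (h : (a : K) + b * x = 0) :
    a = 0 ∧ b = 0 := by
  have hb : b = 0 := by
    by_contra hb
    have hb' : (b : K) ≠ 0 := by exact_mod_cast hb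
    refine hx (-a / b) ?_
    push_cast
    field_simp
    linear_combination h
  subst hb
  exact ⟨by simpa using h, rfl⟩

theorem exists_rat_add_mul (hdeg : Module.finrank ℚ K ≤ 2) {x : K} (hx : ∀ r : ℚ, x ≠ r) (y : K) :
    ∃ a b : ℚ, y = a + b * x := by
  have hli : LinearIndependent ℚ ![(1 : K), x] := by
    rw [LinearIndependent.pair_iff]
    intro a b h
    rw [Rat.smul_def, Rat.smul_def, mul_one] at h
    exact rat_add_mul_eq_zero hx h
  have hspan := hli.span_eq_top_of_card_eq_finrank'
    (le_antisymm hli.fintype_card_le_finrank (by simpa using hdeg))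
  have hy : y ∈ Submodule.span ℚ (Set.range ![(1 : K), x]) := hspan ▸ Submodule.mem_top
  rw [Matrix.range_cons_cons_empty, Submodule.mem_span_pair] at hy
  obtain ⟨a, b, h⟩ := hy
  exact ⟨a, b, by rw [← h, Rat.smul_def, Rat.smul_def, mul_one]⟩

theorem eq_one_or_neg_one_of_rat (hdeg : Module.finrank ℚ K ≤ 2) {x : ℚ} {y z : K}
    (hy : y ^ 2 = -((x : K) ^ 2 - 3) * ((x : K) ^ 2 + 1))
    (hz : z ^ 2 = -2 * ((x : K) ^ 3 - (x : K) ^ 2 - x - 1)) : x = 1 ∨ x = -1 := by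
  by_cases hyr : ∃ r : ℚ, y = r
  · obtain ⟨r, rfl⟩ := hyr
    exact eq_one_or_neg_one_of_rat_quartic (y := r) (by exact_mod_cast hy)
  push Not at hyr
  obtain ⟨a, b, rfl⟩ := exists_rat_add_mul hdeg hyr z
  have h : ((a ^ 2 - b ^ 2 * ((x ^ 2 - 3) * (x ^ 2 + 1)) +
      2 * (x ^ 3 - x ^ 2 - x - 1) : ℚ) : K) + (2 * a * b : ℚ) * y = 0 := by
    push_cast
    linear_combination hz - (b : K) ^ 2 * hy
  obtain ⟨h0, h1⟩ := rat_add_mul_eq_zero hyr h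
  rcases mul_eq_zero.mp h1 with ha | rfl
  · obtain rfl : a = 0 := by simpa using ha
    refine eq_one_or_neg_one_of_rat_product (w := b * (-(x ^ 2 - 3) * (x ^ 2 + 1))) ?_
    linear_combination -(x ^ 2 - 3) * (x ^ 2 + 1) * h0
  · exact eq_one_or_neg_one_of_rat_cubic (z := a) (by linear_combination h0)

theorem exists_rat_eq (hdeg : Module.finrank ℚ K ≤ 2) {x y z : K}
    (hy : y ^ 2 = -(x ^ 2 - 3) * (x ^ 2 + 1))
    (hz : z ^ 2 = -2 * (x ^ 3 - x ^ 2 - x - 1)) : ∃ r : ℚ, x = r := by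
  by_contra! hx
  obtain ⟨B', A', hx2⟩ := exists_rat_add_mul hdeg hx (x ^ 2)
  obtain ⟨A, rfl⟩ : ∃ A, A' = -A := ⟨-A', by ring⟩
  obtain ⟨B, rfl⟩ : ∃ B, B' = -B := ⟨-B', by ring⟩
  push_cast at hx2
  obtain ⟨α, β, rfl⟩ := exists_rat_add_mul hdeg hx z
  obtain ⟨γ, δ, rfl⟩ := exists_rat_add_mul hdeg hx y
  have hroot (r : ℚ) : r ^ 2 + A * r + B ≠ 0 := by
    intro hr
    have hr' : (r : K) ^ 2 + A * r + B = 0 := by exact_mod_cast congrArg (Rat.cast : ℚ → K) hr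
    have : (x - r) * (x - (-r - A : ℚ)) = 0 := by
      push_cast
      linear_combination hx2 - hr'
    rcases mul_eq_zero.mp this with h | h
    · exact hx _ (sub_eq_zero.mp h)
    · exact hx _ (sub_eq_zero.mp h)
  have hzr : ((α ^ 2 - β ^ 2 * B + 2 * (A * B + B - 1) : ℚ) : K) +
      (2 * α * β - β ^ 2 * A + 2 * (A ^ 2 - B + A - 1) : ℚ) * x = 0 := by
    push_cast
    linear_combination hz - (β ^ 2 + 2 * (x - 1 - A) : K) * hx2
  have hyr : ((γ ^ 2 - δ ^ 2 * B - (A ^ 2 * B - B ^ 2 - 2 * B + 3) : ℚ) : K) +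
      (2 * γ * δ - δ ^ 2 * A - (A ^ 3 - 2 * A * B - 2 * A) : ℚ) * x = 0 := by
    push_cast
    linear_combination hy - (δ ^ 2 + x ^ 2 - A * x - B + A ^ 2 - 2 : K) * hx2
  obtain ⟨hz0, hz1⟩ := rat_add_mul_eq_zero hx hzr
  obtain ⟨hy0, hy1⟩ := rat_add_mul_eq_zero hx hyr
  obtain ⟨r, hr⟩ := exists_root_of_quadratic_coeffs (A := A) (B := B)
    (quadratic_coeffs_of_cubic (α := α) (β := β) (by linear_combination hz1)
      (by linear_combination hz0))
    (quadratic_coeffs_of_quartic (γ := γ) (δ := δ) (by simpa using hroot 1)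
      (by linear_combination hy1) (by linear_combination hy0))
  exact hroot r hr

end QuadraticField

theorem points_1_3and_all1_2_curve {K : Type*} [Field K] [NumberField K]
    (hdeg : Module.finrank ℚ K ≤ 2) (x y z : K) :
    (y ^ 2 = -(x ^ 2 - 3) * (x ^ 2 + 1) ∧
        z ^ 2 = -2 * (x ^ 3 - x ^ 2 - x - 1)) ↔
      ((x = 1 ∨ x = -1) ∧ (y = 2 ∨ y = -2) ∧ (z = 2 ∨ z = -2)) := by
  constructor
  · rintro ⟨hy, hz⟩
    obtain ⟨r, rfl⟩ := exists_rat_eq hdeg hy hz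
    refine ⟨?_, ?_, ?_⟩ <;> rcases eq_one_or_neg_one_of_rat hdeg hy hz with rfl | rfl
    · simp
    · simp
    all_goals
      rw [← sq_eq_sq_iff_eq_or_eq_neg]
      first | rw [hy] | rw [hz]
      norm_num
  · rintro ⟨rfl | rfl, rfl | rfl, rfl | rfl⟩ <;> norm_num
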